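/- arXiv:2404.05925 — 14 statements merged into one kernel-verified Lean document; each statement's English description precedes it below -/
import Mathlib

section
/- Let I be a finite nonempty set and m : I × I → ℤ a map. Then there exists a map s : I → ℤ such that m(i, j) + s(i) − s(j) ≥ 0 for all i, j ∈ I if and only if m is Σ-non-negative. -/
/-- The cyclic sum `m(𝔰) = ∑_{k=1}^{n} m(i_k, i_{k+1})` (with `i_{n+1} := i_1`) of `m`
along the sequence `𝔰 = (i_1, …, i_n)`, encoded as a function `s : Fin n → I` with `0 < n`. -/
def cyclicSum {I : Type*} (m : I → I → ℤ) {n : ℕ} (hn : 0 < n) (s : Fin n → I) : ℤ :=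
  ∑ k : Fin n, m (s k) (s ⟨((k : ℕ) + 1) % n, Nat.mod_lt _ hn⟩)

/-- `m` is Σ-non-negative if `m(𝔰) ≥ 0` for every finite sequence `𝔰` in `I` of length `≥ 1`. -/
def SigmaNonneg {I : Type*} (m : I → I → ℤ) : Prop :=
  ∀ (n : ℕ) (hn : 0 < n) (s : Fin n → I), 0 ≤ cyclicSum m hn s

theorem cyclicSum_eq_sum_add_one {I : Type*} (m : I → I → ℤ) {n : ℕ} (hn : 0 < n + 1)
    (s : Fin (n + 1) → I) : cyclicSum m hn s = ∑ k, m (s k) (s (k + 1)) := by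
  refine Finset.sum_congr rfl fun k _ => ?_
  congr 2
  ext
  simp [Fin.val_add]

/-- Closing up a path `f 0, …, f n` adds the edge from `f n` back to `f 0`. -/
theorem cyclicSum_path {I : Type*} (m : I → I → ℤ) (f : ℕ → I) (n : ℕ) :
    cyclicSum m n.succ_pos (fun k => f k) =
      ∑ k ∈ Finset.range n, m (f k) (f (k + 1)) + m (f n) (f 0) := by
  rw [cyclicSum_eq_sum_add_one, Fin.sum_univ_castSucc, Finset.sum_range]
  simp

/-- Cyclic sums are invariant under conjugation. -/
theorem cyclicSum_conj {I : Type*} (m : I → I → ℤ) (t : I → ℤ) {n : ℕ} (hn : 0 < n)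
    (s : Fin n → I) : cyclicSum (fun i j => m i j + t i - t j) hn s = cyclicSum m hn s := by
  obtain _ | n := n
  · exact absurd hn (lt_irrefl 0)
  have h : ∑ k, t (s (k + 1)) = ∑ k, t (s k) :=
    Equiv.sum_comp (Equiv.addRight (1 : Fin (n + 1))) fun k => t (s k)
  simp only [cyclicSum_eq_sum_add_one, Finset.sum_sub_distrib, Finset.sum_add_distrib, h,
    add_sub_cancel_right]

/-- The weights with respect to `m` of the paths from `r` to `j`. -/
def pathWeights {I : Type*} (m : I → I → ℤ) (r j : I) : Set ℤ :=
  {w | ∃ (n : ℕ) (f : ℕ → I), f 0 = r ∧ f n = j ∧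
    ∑ k ∈ Finset.range n, m (f k) (f (k + 1)) = w}

theorem add_mem_pathWeights {I : Type*} (m : I → I → ℤ) {r i : I} (j : I) {w : ℤ}
    (hw : w ∈ pathWeights m r i) : w + m i j ∈ pathWeights m r j := by
  obtain ⟨n, f, rfl, rfl, rfl⟩ := hw
  refine ⟨n + 1, fun k => if k ≤ n then f k else j, by simp, by simp, ?_⟩
  rw [Finset.sum_range_succ]
  congr 1
  · refine Finset.sum_congr rfl fun k hk => ?_
    have hk := Finset.mem_range.1 hk
    simp [hk.le, Nat.succ_le_of_lt hk]
  · simp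

theorem pathWeights_nonempty {I : Type*} (m : I → I → ℤ) (r j : I) :
    (pathWeights m r j).Nonempty :=
  ⟨0 + m r j, add_mem_pathWeights m j ⟨0, fun _ => r, rfl, rfl, by simp⟩⟩

theorem SigmaNonneg.bddBelow_pathWeights {I : Type*} {m : I → I → ℤ} (hm : SigmaNonneg m)
    (r j : I) : BddBelow (pathWeights m r j) := by
  refine ⟨-m j r, ?_⟩
  rintro _ ⟨n, f, rfl, rfl, rfl⟩
  have h := hm (n + 1) n.succ_pos fun k => f k
  rw [cyclicSum_path] at h
  linarith

/-- **Theorem (Lem. A.2 / Theorem `lem-mat-pos`).**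
A map `m : I² → ℤ` on a finite nonempty set `I` admits a non-negative conjugate
`(sm)(i,j) = m(i,j) + s(i) − s(j)` if and only if `m` is Σ-non-negative. -/
theorem stmt_0 {I : Type*} [Fintype I] [Nonempty I] (m : I → I → ℤ) :
    (∃ s : I → ℤ, ∀ i j : I, 0 ≤ m i j + s i - s j) ↔ SigmaNonneg m := by
  constructor
  · rintro ⟨t, ht⟩ n hn s
    rw [← cyclicSum_conj m t hn s]
    exact Finset.sum_nonneg fun k _ => ht _ _
  · intro hm
    obtain ⟨r⟩ := ‹Nonempty I›
    refine ⟨fun j => sInf (pathWeights m r j), fun i j => ?_⟩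
    have hi := Int.csInf_mem (pathWeights_nonempty m r i) (hm.bddBelow_pathWeights r i)
    have hj := csInf_le (hm.bddBelow_pathWeights r j) (add_mem_pathWeights m j hi)
    linarith
end

section
/- Let I be a finite nonempty set and m : I × I → ℤ a Σ-non-negative map. Then for every sequence 𝔰 = (i₁, …, iₙ) in I (n ≥ 1) containing at least two distinct elements, there exists a multiplicity-free sequence 𝔱 in I of length at least 2 such that m(𝔱) ≤ m(𝔰). In particular, the minimum m_min := min{ m(𝔰) : 𝔰 a sequence in I with at least two distinct entries } exists and is attained at a multiplicity-free sequence of length at least 2. -/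
theorem cyclicSum_eq_sum_range {I : Type*} (m : I → I → ℤ) {n : ℕ} (hn : 0 < n) (f : ℕ → I)
    (hf : f n = f 0) :
    cyclicSum m hn (fun k : Fin n => f k) = ∑ k ∈ Finset.range n, m (f k) (f (k + 1)) := by
  rw [← Fin.sum_univ_eq_sum_range (fun k => m (f k) (f (k + 1))) n]
  unfold cyclicSum
  refine Finset.sum_congr rfl fun k _ => ?_
  rcases Nat.lt_or_ge (k + 1) n with h | h
  · simp [Nat.mod_eq_of_lt h]
  · have hk : (k : ℕ) + 1 = n := by have := k.isLt; omega
    simp [hk, hf]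

theorem exists_closed_extension {I : Type*} {n : ℕ} (hn : 0 < n) (s : Fin n → I) :
    ∃ f : ℕ → I, f n = f 0 ∧ (fun k : Fin n => f k) = s :=
  ⟨fun k => s ⟨k % n, Nat.mod_lt _ hn⟩, by simp, by
    funext k
    simp [Nat.mod_eq_of_lt k.isLt]⟩

/-- Cutting a closed walk at a repeated vertex splits its sum into those of two closed walks. -/
theorem sum_range_eq_add_of_eq {I : Type*} (m : I → I → ℤ) (f : ℕ → I) {n a b : ℕ}
    (hab : a < b) (hbn : b < n) (h : f a = f b) :
    ∑ k ∈ Finset.range n, m (f k) (f (k + 1)) =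
      ∑ k ∈ Finset.range (b - a), m (f (a + k)) (f (a + (k + 1))) +
      ∑ k ∈ Finset.range (n - (b - a)), m (if k ≤ a then f k else f (k + (b - a)))
        (if k + 1 ≤ a then f (k + 1) else f (k + 1 + (b - a))) := by
  obtain ⟨c, rfl⟩ := Nat.exists_eq_add_of_lt hab
  obtain ⟨d, rfl⟩ := Nat.exists_eq_add_of_lt hbn
  have h1 : a + c + 1 - a = c + 1 := by omega
  have h2 : a + c + 1 + d + 1 - (c + 1) = a + (d + 1) := by omega
  have h3 : a + c + 1 + d + 1 = a + (c + 1) + (d + 1) := by omega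
  rw [h1, h2, h3, Finset.sum_range_add _ (a + (c + 1)), Finset.sum_range_add _ a (c + 1),
    Finset.sum_range_add _ a (d + 1)]
  have e1 : ∑ k ∈ Finset.range a, m (if k ≤ a then f k else f (k + (c + 1)))
        (if k + 1 ≤ a then f (k + 1) else f (k + 1 + (c + 1))) =
      ∑ k ∈ Finset.range a, m (f k) (f (k + 1)) := by
    refine Finset.sum_congr rfl fun k hk => ?_
    have hk := Finset.mem_range.1 hk
    rw [if_pos (by omega), if_pos (by omega)]
  have e2 : ∑ k ∈ Finset.range (d + 1),
        m (if a + k ≤ a then f (a + k) else f (a + k + (c + 1)))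
          (if a + k + 1 ≤ a then f (a + k + 1) else f (a + k + 1 + (c + 1))) =
      ∑ k ∈ Finset.range (d + 1), m (f (a + (c + 1) + k)) (f (a + (c + 1) + k + 1)) := by
    refine Finset.sum_congr rfl fun k _ => ?_
    rw [if_neg (show ¬ a + k + 1 ≤ a by omega),
      show a + k + 1 + (c + 1) = a + (c + 1) + k + 1 by omega]
    congr 1
    split_ifs with hk
    · obtain rfl : k = 0 := by omega
      exact h
    · congr 1
      omega
  rw [e1, e2]
  simp only [← add_assoc]
  ring

theorem SigmaNonneg.sum_range_nonneg {I : Type*} {m : I → I → ℤ} (hm : SigmaNonneg m) {n : ℕ}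
    (hn : 0 < n) (f : ℕ → I) (hf : f n = f 0) :
    0 ≤ ∑ k ∈ Finset.range n, m (f k) (f (k + 1)) :=
  cyclicSum_eq_sum_range m hn f hf ▸ hm n hn _

theorem SigmaNonneg.exists_injective_le_sum_range {I : Type*} {m : I → I → ℤ}
    (hm : SigmaNonneg m) (n : ℕ) (f : ℕ → I) (hf : f n = f 0) (hne : ∃ k < n, f k ≠ f 0) :
    ∃ (n' : ℕ) (hn' : 0 < n') (t : Fin n' → I), Function.Injective t ∧ 2 ≤ n' ∧
      cyclicSum m hn' t ≤ ∑ k ∈ Finset.range n, m (f k) (f (k + 1)) := by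
  induction n using Nat.strong_induction_on generalizing f with
  | _ n ih =>
  obtain ⟨k₀, hk₀, hk₀ne⟩ := hne
  have hk₀pos : k₀ ≠ 0 := by
    rintro rfl
    exact hk₀ne rfl
  by_cases hinj : Function.Injective (fun k : Fin n => f k)
  · exact ⟨n, by omega, _, hinj, by omega, (cyclicSum_eq_sum_range m _ f hf).le⟩
  obtain ⟨a, b, hab, hbn, h⟩ : ∃ a b, a < b ∧ b < n ∧ f a = f b := by
    simp only [Function.Injective, not_forall] at hinj
    obtain ⟨x, y, hxy, hne⟩ := hinj
    rcases Nat.lt_or_gt_of_ne (fun e => hne (Fin.ext e)) with hlt | hlt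
    · exact ⟨x, y, hlt, y.isLt, hxy⟩
    · exact ⟨y, x, hlt, x.isLt, hxy.symm⟩
  have hsum := sum_range_eq_add_of_eq m f hab hbn h
  let g : ℕ → I := fun k => f (a + k)
  let o : ℕ → I := fun k => if k ≤ a then f k else f (k + (b - a))
  have hg : g (b - a) = g 0 := by
    simp only [g, add_zero, h]
    congr 1
    omega
  have ho : o (n - (b - a)) = o 0 := by
    simp only [o, Nat.zero_le, if_true]
    rw [if_neg (by omega), ← hf]
    congr 1
    omega
  have hg0 := hm.sum_range_nonneg (by omega) g hg
  have ho0 := hm.sum_range_nonneg (by omega) o ho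
  by_cases hgc : ∃ k < b - a, g k ≠ g 0
  · obtain ⟨n', hn', t, ht, h2, hle⟩ := ih (b - a) (by omega) g hg hgc
    exact ⟨n', hn', t, ht, h2, by simp only [g, o] at *; linarith⟩
  have hoc : ∃ k < n - (b - a), o k ≠ o 0 := by
    push Not at hgc
    by_cases ha : f a = f 0
    · rcases Nat.lt_or_ge k₀ a with hka | hka
      · exact ⟨k₀, by omega, by simpa [o, hka.le] using hk₀ne⟩
      rcases Nat.lt_or_ge b k₀ with hkb | hkb
      · refine ⟨k₀ - (b - a), by omega, ?_⟩
        have e : k₀ - (b - a) + (b - a) = k₀ := by omega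
        simpa [o, e, show ¬ k₀ - (b - a) ≤ a by omega] using hk₀ne
      · refine absurd ?_ hk₀ne
        rcases hkb.eq_or_lt with rfl | hkb
        · exact h.symm.trans ha
        · have := hgc (k₀ - a) (by omega)
          simp only [g, add_zero, Nat.add_sub_cancel' hka] at this
          exact this.trans ha
    · exact ⟨a, by omega, by simpa [o] using ha⟩
  obtain ⟨n', hn', t, ht, h2, hle⟩ := ih (n - (b - a)) (by omega) o ho hoc
  exact ⟨n', hn', t, ht, h2, by simp only [g, o] at *; linarith⟩

theorem SigmaNonneg.exists_injective_cyclicSum_le {I : Type*} {m : I → I → ℤ}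
    (hm : SigmaNonneg m) {n : ℕ} (hn : 0 < n) (s : Fin n → I) (hs : ∃ k l : Fin n, s k ≠ s l) :
    ∃ (n' : ℕ) (hn' : 0 < n') (t : Fin n' → I), Function.Injective t ∧ 2 ≤ n' ∧
      cyclicSum m hn' t ≤ cyclicSum m hn s := by
  obtain ⟨f, hf, rfl⟩ := exists_closed_extension hn s
  rw [cyclicSum_eq_sum_range m hn f hf]
  refine hm.exists_injective_le_sum_range n f hf ?_
  by_contra! hc
  obtain ⟨k, l, hkl⟩ := hs
  exact hkl ((hc k k.isLt).trans (hc l l.isLt).symm)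

/-- **Lemma (easy fact of m (2)).** Let `I` be a finite nonempty set and `m : I × I → ℤ`
Σ-non-negative.  For every sequence `𝔰` in `I` containing at least two distinct elements
there is a multiplicity-free sequence `𝔱` of length at least `2` with `m(𝔱) ≤ m(𝔰)`.
In particular the minimum `m_min` over all sequences with at least two distinct entries
exists and is attained at a multiplicity-free sequence of length at least `2`. -/
theorem stmt_1 {I : Type*} [Fintype I] [Nonempty I] (m : I → I → ℤ)
    (hm : SigmaNonneg m) :
    (∀ (n : ℕ) (hn : 0 < n) (s : Fin n → I), (∃ k l : Fin n, s k ≠ s l) →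
      ∃ (n' : ℕ) (hn' : 0 < n') (t : Fin n' → I), Function.Injective t ∧ 2 ≤ n' ∧
        cyclicSum m hn' t ≤ cyclicSum m hn s) ∧
    (Nontrivial I →
      ∃ (n' : ℕ) (hn' : 0 < n') (t : Fin n' → I), Function.Injective t ∧ 2 ≤ n' ∧
        ∀ (n : ℕ) (hn : 0 < n) (s : Fin n → I), (∃ k l : Fin n, s k ≠ s l) →
          cyclicSum m hn' t ≤ cyclicSum m hn s) := by
  refine ⟨fun n hn s hs => hm.exists_injective_cyclicSum_le hn s hs, fun ⟨x, y, hxy⟩ => ?_⟩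
  obtain ⟨v, ⟨n, hn, s, hs, rfl⟩, hmin⟩ := Int.exists_least_of_bdd
    (P := fun v => ∃ (n : ℕ) (hn : 0 < n) (s : Fin n → I),
      (∃ k l : Fin n, s k ≠ s l) ∧ cyclicSum m hn s = v)
    ⟨0, by rintro _ ⟨n, hn, s, -, rfl⟩; exact hm n hn s⟩
    ⟨_, 2, two_pos, ![x, y], ⟨0, 1, hxy⟩, rfl⟩
  obtain ⟨n', hn', t, ht, h2, hle⟩ := hm.exists_injective_cyclicSum_le hn s hs
  exact ⟨n', hn', t, ht, h2, fun n₁ hn₁ s₁ hs₁ => hle.trans (hmin _ ⟨n₁, hn₁, s₁, hs₁, rfl⟩)⟩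
end

section
/- Let I be a finite nonempty set and m : I × I → ℤ a map. (a) If m is Σ-non-negative, then Σ_{i∈I} m(i, σ(i)) ≥ 0 for every permutation σ of I. (b) Conversely, if m(i, i) = 0 for all i ∈ I and Σ_{i∈I} m(i, σ(i)) ≥ 0 for every permutation σ of I, then m is Σ-non-negative. -/
open Finset in
/-- Going around every `σ`-orbit `orderOf σ` times counts each `m i (σ i)` equally often. -/
theorem SigmaNonneg.sum_perm_nonneg {I : Type*} [Fintype I] {m : I → I → ℤ}
    (h : SigmaNonneg m) (σ : Equiv.Perm I) : 0 ≤ ∑ i, m i (σ i) := by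
  have hN : 0 < orderOf σ := orderOf_pos σ
  have horbit (i : I) : 0 ≤ ∑ k : Fin (orderOf σ), m ((σ ^ (k : ℕ)) i) (σ ((σ ^ (k : ℕ)) i)) := by
    convert h _ hN fun k => (σ ^ (k : ℕ)) i using 1
    refine sum_congr rfl fun k _ => ?_
    simp only [pow_mod_orderOf, pow_succ', Equiv.Perm.mul_apply]
  have hsum : 0 ≤ ∑ i, ∑ k : Fin (orderOf σ), m ((σ ^ (k : ℕ)) i) (σ ((σ ^ (k : ℕ)) i)) :=
    sum_nonneg fun i _ => horbit i
  rw [sum_comm, sum_congr rfl fun (k : Fin (orderOf σ)) _ =>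
    Equiv.sum_comp (σ ^ (k : ℕ)) fun i => m i (σ i)] at hsum
  simp only [sum_const, card_univ, Fintype.card_fin, nsmul_eq_mul] at hsum
  exact nonneg_of_mul_nonneg_right hsum (by exact_mod_cast hN)

open Finset in
/-- The sum of `m` along a simple closed walk is a permutation sum of `m`. -/
theorem sum_simple_closed_walk_nonneg {I : Type*} [Fintype I] {m : I → I → ℤ}
    (h0 : ∀ i, m i i = 0) (h : ∀ σ : Equiv.Perm I, 0 ≤ ∑ i, m i (σ i)) {n : ℕ} {f : ℕ → I}
    (hf : f n = f 0) (hinj : Function.Injective fun k : Fin n => f k) :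
    0 ≤ ∑ k ∈ range n, m (f k) (f (k + 1)) := by
  classical
  obtain _ | n := n
  · simp
  let e : Fin (n + 1) ↪ I := ⟨fun k => f k, hinj⟩
  have hstep (k : Fin (n + 1)) : e (finRotate (n + 1) k) = f (k + 1) := by
    change f (finRotate (n + 1) k : Fin (n + 1)) = f (k + 1)
    rw [finRotate_apply, Fin.val_add_one]
    split_ifs with hk
    · simp [hk, hf]
    · rfl
  refine (h ((finRotate (n + 1)).viaFintypeEmbedding e)).trans_eq ?_
  rw [← sum_subset (subset_univ (univ.map e)), sum_map, sum_range]
  · refine sum_congr rfl fun k _ => ?_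
    rw [Equiv.Perm.viaFintypeEmbedding_apply_image, hstep]
    rfl
  · intro i _ hi
    rw [Equiv.Perm.viaFintypeEmbedding_apply_notMem_range _ _ (by simpa using hi), h0]

open Finset in
/-- A closed walk that is not simple splits at a repeated vertex into two shorter closed walks. -/
theorem sum_closed_walk_nonneg {I : Type*} [Fintype I] {m : I → I → ℤ}
    (h0 : ∀ i, m i i = 0) (h : ∀ σ : Equiv.Perm I, 0 ≤ ∑ i, m i (σ i)) (n : ℕ) (f : ℕ → I)
    (hf : f n = f 0) : 0 ≤ ∑ k ∈ range n, m (f k) (f (k + 1)) := by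
  induction n using Nat.strong_induction_on generalizing f with
  | _ n ih =>
  by_cases hinj : Function.Injective fun k : Fin n => f k
  · exact sum_simple_closed_walk_nonneg h0 h hf hinj
  obtain ⟨a, d, c, hd, hc, hn, hfab⟩ :
      ∃ a d c, 0 < d ∧ 0 < c ∧ n = a + d + c ∧ f (a + d) = f a := by
    simp only [Function.Injective, not_forall] at hinj
    obtain ⟨x, y, hxy, hne⟩ := hinj
    rcases lt_or_gt_of_ne hne with hlt | hlt
    · have hlt : (x : ℕ) < y := hlt
      refine ⟨x, y - x, n - y, by lia, by lia, by lia, ?_⟩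
      rw [Nat.add_sub_cancel' hlt.le]
      exact hxy.symm
    · have hlt : (y : ℕ) < x := hlt
      refine ⟨y, x - y, n - x, by lia, by lia, by lia, ?_⟩
      rw [Nat.add_sub_cancel' hlt.le]
      exact hxy
  subst hn
  have hinner := ih d (by lia) (fun k => f (a + k)) hfab
  let g : ℕ → I := fun k => if k ≤ a then f k else f (k + d)
  have hg_le {k : ℕ} (hk : k ≤ a) : g k = f k := if_pos hk
  have hg_add (k : ℕ) : g (a + k) = f (a + d + k) := by
    obtain _ | k := k
    · simpa [g] using hfab.symm
    · rw [add_right_comm]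
      exact if_neg (by lia)
  have houter := ih (a + c) (by lia) g (by rw [hg_add, hf, hg_le a.zero_le])
  have hhead : ∑ k ∈ range a, m (g k) (g (k + 1)) = ∑ k ∈ range a, m (f k) (f (k + 1)) :=
    sum_congr rfl fun k hk => by
      have := mem_range.1 hk
      rw [hg_le this.le, hg_le this]
  rw [sum_range_add, hhead] at houter
  simp only [add_assoc a, hg_add] at houter
  simp only [sum_range_add, add_assoc] at hinner houter ⊢
  linarith

/-- **Lemma (easy fact of m (3)).**
(a) If `m` is Σ-non-negative, then `∑_{i ∈ I} m(i, σ(i)) ≥ 0` for every permutation `σ` of `I`.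
(b) Conversely, if `m(i,i) = 0` for all `i` and `∑_{i ∈ I} m(i, σ(i)) ≥ 0` for every permutation
`σ` of `I`, then `m` is Σ-non-negative. -/
theorem stmt_2 {I : Type*} [Fintype I] [Nonempty I] (m : I → I → ℤ) :
    (SigmaNonneg m → ∀ σ : Equiv.Perm I, 0 ≤ ∑ i : I, m i (σ i)) ∧
    ((∀ i : I, m i i = 0) → (∀ σ : Equiv.Perm I, 0 ≤ ∑ i : I, m i (σ i)) →
      SigmaNonneg m) := by
  refine ⟨fun h => h.sum_perm_nonneg, fun h0 h n hn s => ?_⟩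
  have := sum_closed_walk_nonneg h0 h n (fun k => s ⟨k % n, Nat.mod_lt _ hn⟩) (by simp)
  rw [Finset.sum_range] at this
  simpa only [cyclicSum, Nat.mod_eq_of_lt (Fin.is_lt _)] using this
end

section
/- Let n ≥ 2, I = {0, 1, …, n−1}, and m : I × I → ℤ a Σ-non-negative map. Let m_min := min{ m(𝔰) : 𝔰 a sequence in I with at least two distinct entries } (which exists since m is Σ-non-negative), and assume that the sequence 𝔦 = (0, 1, …, n−1) satisfies m(𝔦) = m_min. Then there exists s : I → ℤ such that the conjugate m' := sm satisfies: (1) m'(i, j) ≥ 0 for all i, j ∈ I; (2) m'(i, i+1) = 0 for all 0 ≤ i ≤ n−2 and m'(n−1, 0) = m_min. -/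
theorem cyclicSum_succ {I : Type*} (m : I → I → ℤ) {n : ℕ} (hn : 0 < n + 1) (s : Fin (n + 1) → I) :
    cyclicSum m hn s =
      ∑ k : Fin n, m (s k.castSucc) (s k.succ) + m (s (Fin.last n)) (s 0) := by
  unfold cyclicSum
  rw [Fin.sum_univ_castSucc]
  congr 1
  · refine Finset.sum_congr rfl fun k _ => ?_
    congr 2
    ext
    simp [Nat.mod_eq_of_lt]
  · congr 2
    ext
    simp

/-- A map on `Fin (n + 1)` which vanishes on consecutive pairs and whose value at `(n, 0)` is a
lower bound for the cyclic sums of non-constant sequences is non-negative. -/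
theorem nonneg_of_le_cyclicSum {n : ℕ} (m : Fin (n + 1) → Fin (n + 1) → ℤ)
    (hm : SigmaNonneg m) (hsucc : ∀ k : Fin n, m k.castSucc k.succ = 0)
    (hmin : ∀ (n' : ℕ) (hn' : 0 < n') (s : Fin n' → Fin (n + 1)), (∃ k l, s k ≠ s l) →
      m (Fin.last n) 0 ≤ cyclicSum m hn' s) (i j : Fin (n + 1)) : 0 ≤ m i j := by
  rcases lt_trichotomy j i with h | rfl | h
  · have hs := hm ((i : ℕ) - j + 1) (by omega) fun k => ⟨j + k, by omega⟩
    rw [cyclicSum_succ, Finset.sum_eq_zero] at hs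
    · convert hs using 1
      rw [zero_add]
      congr 1
      ext
      simp
      omega
    · intro k _
      exact hsucc ⟨j + k, by omega⟩
  · simpa [cyclicSum] using hm 1 one_pos fun _ => j
  · have hlast : Fin.ofNat (n + 1) (j + (n + 1 - j + i)) = i := by
      ext
      rw [Fin.val_ofNat, show (j : ℕ) + (n + 1 - j + i) = i + (n + 1) by omega,
        Nat.add_mod_right, Nat.mod_eq_of_lt i.isLt]
    have hzero : Fin.ofNat (n + 1) (j + 0) = j := by
      ext
      simp
    have hs := hmin (n + 1 - (j : ℕ) + i + 1) (by omega) (fun k => Fin.ofNat (n + 1) (j + k))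
      ⟨Fin.last _, 0, by
        simp only [Fin.val_last, Fin.val_zero, hlast, hzero]
        exact h.ne⟩
    rw [cyclicSum_succ] at hs
    simp only [Fin.val_last, Fin.val_zero, hlast, hzero, Fin.val_castSucc, Fin.val_succ] at hs
    rw [Finset.sum_eq_single (⟨n - j, by omega⟩ : Fin (n + 1 - (j : ℕ) + i))] at hs
    · have hn₁ : Fin.ofNat (n + 1) (j + (n - j)) = Fin.last n := by
        ext
        rw [Fin.val_ofNat, show (j : ℕ) + (n - j) = n by omega]
        simp
      have hn₂ : Fin.ofNat (n + 1) (j + (n - j + 1)) = 0 := by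
        ext
        rw [Fin.val_ofNat, show (j : ℕ) + (n - j + 1) = n + 1 by omega]
        simp
      simp only [hn₁, hn₂] at hs
      linarith
    · intro k _ hk
      have hk' : (k : ℕ) ≠ n - j := fun e => hk (Fin.ext e)
      rcases lt_or_gt_of_ne hk' with hlt | hgt
      · convert hsucc ⟨j + k, by omega⟩ using 2
        · ext
          rw [Fin.val_ofNat, Nat.mod_eq_of_lt (by omega), Fin.val_castSucc]
        · ext
          rw [Fin.val_ofNat, Nat.mod_eq_of_lt (by omega), Fin.val_succ]
          dsimp only
          omega
      · convert hsucc ⟨j + k - (n + 1), by omega⟩ using 2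
        · ext
          rw [Fin.val_ofNat, Nat.mod_eq_sub_mod (by omega), Nat.mod_eq_of_lt (by omega)]
          simp
        · ext
          rw [Fin.val_ofNat, Nat.mod_eq_sub_mod (by omega), Nat.mod_eq_of_lt (by omega),
            Fin.val_succ]
          dsimp only
          omega
    · simp

/-- **Lemma (`lem-cyc-pos`).**  Let `I = {0,1,…,n−1}` (with `n ≥ 2`) and let
`m : I² → ℤ` be Σ-non-negative.  Assume that the sequence `𝔦 = (0,1,…,n−1)` realizes the
minimum `m_min` of `m(𝔰)` over all sequences `𝔰` with at least two distinct entries.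
Then `m` admits a conjugate `m' = sm` which is non-negative and normalized, i.e.
`m'(i, i+1) = 0` for `0 ≤ i ≤ n−2` and `m'(n−1, 0) = m_min`. -/
theorem stmt_3 (n : ℕ) (hn : 2 ≤ n) (m : Fin n → Fin n → ℤ)
    (hm : SigmaNonneg m)
    (hmin : ∀ (n' : ℕ) (hn' : 0 < n') (s : Fin n' → Fin n), (∃ k l : Fin n', s k ≠ s l) →
      cyclicSum m (show 0 < n by omega) (id : Fin n → Fin n) ≤ cyclicSum m hn' s) :
    ∃ s : Fin n → ℤ,
      (∀ i j : Fin n, 0 ≤ m i j + s i - s j) ∧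
      (∀ (i : Fin n) (h : (i : ℕ) + 1 < n),
        m i ⟨(i : ℕ) + 1, h⟩ + s i - s ⟨(i : ℕ) + 1, h⟩ = 0) ∧
      (m ⟨n - 1, by omega⟩ ⟨0, by omega⟩ + s ⟨n - 1, by omega⟩ - s ⟨0, by omega⟩ =
        cyclicSum m (show 0 < n by omega) (id : Fin n → Fin n)) := by
  obtain ⟨n, rfl⟩ : ∃ k, n = k + 1 := ⟨n - 1, by omega⟩
  let t : Fin (n + 1) → ℤ := fun i =>
    ∑ k ∈ Finset.range i, m (Fin.ofNat (n + 1) k) (Fin.ofNat (n + 1) (k + 1))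
  have hsucc : ∀ k : Fin n, m k.castSucc k.succ + t k.castSucc - t k.succ = 0 := by
    intro k
    have h₁ : Fin.ofNat (n + 1) k = k.castSucc := by
      ext
      rw [Fin.val_ofNat, Nat.mod_eq_of_lt (by omega), Fin.val_castSucc]
    have h₂ : Fin.ofNat (n + 1) (k + 1) = k.succ := by
      ext
      rw [Fin.val_ofNat, Nat.mod_eq_of_lt (by omega), Fin.val_succ]
    simp only [t, Fin.val_succ, Fin.val_castSucc, Finset.sum_range_succ, h₁, h₂]
    ring
  have hlast : m (Fin.last n) 0 + t (Fin.last n) - t 0 = cyclicSum m (by omega) id := by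
    rw [← cyclicSum_conj m t, cyclicSum_succ]
    simp [hsucc]
  refine ⟨t, ?_, fun i h => hsucc ⟨i, by omega⟩, hlast⟩
  refine nonneg_of_le_cyclicSum (fun i j => m i j + t i - t j) ?_ hsucc ?_
  · intro n' hn' s
    rw [cyclicSum_conj]
    exact hm n' hn' s
  · intro n' hn' s hs
    rw [cyclicSum_conj, hlast]
    exact hmin n' hn' s hs
end

section
/- Let n > 0 and r ∈ ℤ with gcd(n, r) = 1. Then for every p ∈ ℤ, p = Σ_{i=0}^{n−1} ( ⌊ir/n⌋ − ⌊(ir − p)/n⌋ ). -/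
/-- Multiplication by a unit modulo `n` followed by a translation permutes the residues, so the
sum of the remainders is that of all residues. -/
theorem sum_range_mul_add_emod (n : ℕ) (hn : 0 < n) (r : ℤ) (hcop : Int.gcd (n : ℤ) r = 1)
    (c : ℤ) :
    ∑ i ∈ Finset.range n, ((i : ℤ) * r + c) % (n : ℤ) = ∑ i ∈ Finset.range n, (i : ℤ) := by
  have hn' : (0 : ℤ) < n := by exact_mod_cast hn
  have hcast (i : ℕ) :
      ((((i : ℤ) * r + c) % (n : ℤ)).toNat : ℤ) = ((i : ℤ) * r + c) % (n : ℤ) :=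
    Int.toNat_of_nonneg (Int.emod_nonneg _ hn'.ne')
  have hmaps : Set.MapsTo (fun i : ℕ => (((i : ℤ) * r + c) % (n : ℤ)).toNat)
      (Finset.range n) (Finset.range n) := by
    intro i _
    have := Int.emod_lt_of_pos ((i : ℤ) * r + c) hn'
    have := hcast i
    simp only [Finset.coe_range, Set.mem_Iio]
    lia
  have hinj : Set.InjOn (fun i : ℕ => (((i : ℤ) * r + c) % (n : ℤ)).toNat)
      (Finset.range n) := by
    intro i hi j hj hij
    simp only [Finset.coe_range, Set.mem_Iio] at hi hj hij
    have h : ((i : ℤ) * r + c) % (n : ℤ) = ((j : ℤ) * r + c) % (n : ℤ) := by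
      rw [← hcast i, ← hcast j, hij]
    have hdvd : (n : ℤ) ∣ ((j : ℤ) - i) * r := by
      have := Int.ModEq.dvd h
      ring_nf at this ⊢
      exact this
    have hmod : (i : ℤ) ≡ j [ZMOD n] :=
      Int.modEq_of_dvd (Int.dvd_of_dvd_mul_left_of_gcd_one hdvd hcop)
    exact Nat.ModEq.eq_of_lt_of_lt (Int.natCast_modEq_iff.mp hmod) hi hj
  exact Finset.sum_nbij (fun i : ℕ => (((i : ℤ) * r + c) % (n : ℤ)).toNat) hmaps hinj
    (Finset.surjOn_of_injOn_of_card_le _ hmaps hinj le_rfl) fun i _ => (hcast i).symm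

/-- **Lemma (`floor sequence` (2)).**  Let `n > 0` and `r ∈ ℤ` with `gcd(n, r) = 1`.  Then for
every `p ∈ ℤ` one has `p = ∑_{i=0}^{n−1} (⌊ir/n⌋ − ⌊(ir − p)/n⌋)`. -/
theorem stmt_6 (n : ℕ) (hn : 0 < n) (r : ℤ) (hcop : Int.gcd (n : ℤ) r = 1) (p : ℤ) :
    p = ∑ i ∈ Finset.range n,
      (⌊(((i : ℤ) * r : ℤ) : ℚ) / (n : ℚ)⌋ - ⌊(((i : ℤ) * r - p : ℤ) : ℚ) / (n : ℚ)⌋) := by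
  simp only [Rat.floor_intCast_div_natCast]
  have hn' : (n : ℤ) ≠ 0 := by exact_mod_cast hn.ne'
  apply mul_left_cancel₀ hn'
  have hterm (i : ℕ) : (n : ℤ) * ((i : ℤ) * r / n - ((i : ℤ) * r - p) / n) =
      p - ((i : ℤ) * r + 0) % n + ((i : ℤ) * r + -p) % n := by
    rw [add_zero, ← sub_eq_add_neg, Int.emod_def, Int.emod_def]
    ring
  rw [Finset.mul_sum, Finset.sum_congr rfl fun i _ => hterm i, Finset.sum_add_distrib,
    Finset.sum_sub_distrib, sum_range_mul_add_emod n hn r hcop,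
    sum_range_mul_add_emod n hn r hcop]
  simp
end

section
/- Every m-data (m, a, ν) on a finite nonempty set I admits a map s : I → ℤ such that the conjugate m-data s(m, a, ν) = (sm, sa, ν) is of floor type. In particular, every m-data is conjugate to an almost constant m-data. -/
/-- The `ν`-orbit of `i`, as a finset. -/
noncomputable def orbitFinset {I : Type*} [Fintype I] (ν : Equiv.Perm I) (i : I) : Finset I :=
  Set.Finite.toFinset (Set.toFinite {j | ν.SameCycle i j})

/-- Condition (1) in the definition of an m-data:
`m(ν(i), ν(j)) = m(i, j) − a(i) + a(j)` for all `i, j`. -/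
def MCompat {I : Type*} (m : I → I → ℤ) (a : I → ℤ) (ν : Equiv.Perm I) : Prop :=
  ∀ i j : I, m (ν i) (ν j) = m i j - a i + a j

/-- Condition (2) in the definition of an m-data: for every `ν`-orbit `I'` one has
`∑_{i ∈ I'} a(i) = a_av · #I'`. -/
def OrbitAvg {I : Type*} [Fintype I] (a : I → ℤ) (ν : Equiv.Perm I) (aav : ℚ) : Prop :=
  ∀ i : I, ((∑ j ∈ orbitFinset ν i, a j : ℤ) : ℚ) = aav * ((orbitFinset ν i).card : ℚ)

/-- An m-data (with common orbit average `aav`) is of floor type if every `ν`-orbit `O`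
has a point `i₀` with `a(ν^k(i₀)) = ⌊(k+1)·a_av⌋ − ⌊k·a_av⌋` for all `0 ≤ k ≤ #O − 1`. -/
def IsFloorType {I : Type*} [Fintype I] (a : I → ℤ) (ν : Equiv.Perm I) (aav : ℚ) : Prop :=
  ∀ i : I, ∃ i₀ : I, ν.SameCycle i i₀ ∧
    ∀ k : ℕ, k < (orbitFinset ν i).card →
      a ((ν ^ k) i₀) = ⌊((k : ℚ) + 1) * aav⌋ - ⌊(k : ℚ) * aav⌋

/-- A family of integers is almost constant if all its values lie in `{c, c+1}`
for some integer `c`. -/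
def AlmostConstant {I : Type*} (a : I → ℤ) : Prop :=
  ∃ c : ℤ, ∀ i : I, a i = c ∨ a i = c + 1

open Finset Function in
/-- The iterates of `ν` at `x` below the minimal period enumerate the orbit of `x`. -/
theorem sum_orbitFinset_eq_sum_range {I M : Type*} [Fintype I] [AddCommMonoid M]
    (ν : Equiv.Perm I) (x : I) (f : I → M) :
    ∑ j ∈ orbitFinset ν x, f j = ∑ l ∈ range (minimalPeriod ν x), f ((ν ^ l) x) := by
  symm
  refine sum_bij (fun l _ => (ν ^ l) x) ?_ ?_ ?_ (fun _ _ => rfl)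
  · intro l _
    simpa [orbitFinset] using (Equiv.Perm.SameCycle.refl ν x)
  · intro k hk l hl h
    rw [mem_range] at hk hl
    simp only [← Equiv.Perm.iterate_eq_pow] at h
    exact iterate_injOn_Iio_minimalPeriod hk hl h
  · intro j hj
    have hj : ν.SameCycle x j := by simpa [orbitFinset] using hj
    obtain ⟨k, rfl⟩ := hj.exists_nat_pow_eq
    have hpos : 0 < minimalPeriod ν x :=
      minimalPeriod_pos_of_mem_periodicPts (ν.injective.mem_periodicPts x)
    refine ⟨k % minimalPeriod ν x, mem_range.2 (Nat.mod_lt _ hpos), ?_⟩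
    simp only [← Equiv.Perm.iterate_eq_pow]
    exact iterate_mod_minimalPeriod_eq

/-- The discrepancy between the partial sums of `a` along the orbit of `x` and the floors of the
multiples of `q`. -/
def floorDiscrepancy {I : Type*} (a : I → ℤ) (ν : Equiv.Perm I) (q : ℚ) (x : I) (k : ℕ) : ℤ :=
  ∑ l ∈ Finset.range k, a ((ν ^ l) x) - ⌊(k : ℚ) * q⌋

open Finset Function in
theorem floorDiscrepancy_periodic {I : Type*} [Fintype I] {a : I → ℤ} {ν : Equiv.Perm I} {q : ℚ}
    (havg : OrbitAvg a ν q) (x : I) :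
    Periodic (floorDiscrepancy a ν q x) (minimalPeriod ν x) := by
  intro k
  have hcard : (orbitFinset ν x).card = minimalPeriod ν x := by
    simpa using sum_orbitFinset_eq_sum_range ν x (fun _ => (1 : ℕ))
  have hsum := havg x
  rw [sum_orbitFinset_eq_sum_range, hcard] at hsum
  have hshift (l : ℕ) : (ν ^ (minimalPeriod ν x + l)) x = (ν ^ l) x := by
    rw [add_comm]
    simp only [← Equiv.Perm.iterate_eq_pow]
    exact iterate_add_minimalPeriod_eq
  have hfloor : ⌊((k + minimalPeriod ν x : ℕ) : ℚ) * q⌋ =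
      ⌊(k : ℚ) * q⌋ + ∑ l ∈ range (minimalPeriod ν x), a ((ν ^ l) x) := by
    rw [← Int.floor_add_intCast, hsum]
    congr 1
    push_cast
    ring
  unfold floorDiscrepancy
  rw [hfloor, add_comm k, sum_range_add]
  simp only [hshift]
  ring

theorem floorDiscrepancy_eq_of_pow_eq {I : Type*} [Fintype I] {a : I → ℤ} {ν : Equiv.Perm I}
    {q : ℚ} (havg : OrbitAvg a ν q) {x : I} {k l : ℕ} (h : (ν ^ k) x = (ν ^ l) x) :
    floorDiscrepancy a ν q x k = floorDiscrepancy a ν q x l := by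
  have hpos : 0 < Function.minimalPeriod ν x :=
    Function.minimalPeriod_pos_of_mem_periodicPts (ν.injective.mem_periodicPts x)
  have hmod : k % Function.minimalPeriod ν x = l % Function.minimalPeriod ν x := by
    simp only [← Equiv.Perm.iterate_eq_pow] at h
    refine Function.iterate_injOn_Iio_minimalPeriod (Nat.mod_lt _ hpos) (Nat.mod_lt _ hpos) ?_
    simpa only [Function.iterate_mod_minimalPeriod_eq] using h
  rw [← (floorDiscrepancy_periodic havg x).map_mod_nat k, hmod,
    (floorDiscrepancy_periodic havg x).map_mod_nat l]

theorem floor_succ_mul_sub_floor_mul (q : ℚ) (k : ℕ) :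
    ⌊((k : ℚ) + 1) * q⌋ - ⌊(k : ℚ) * q⌋ = ⌊q⌋ ∨
      ⌊((k : ℚ) + 1) * q⌋ - ⌊(k : ℚ) * q⌋ = ⌊q⌋ + 1 := by
  have h₁ := Int.le_floor_add ((k : ℚ) * q) q
  have h₂ := Int.le_floor_add_floor ((k : ℚ) * q) q
  rw [add_one_mul]
  omega

/-- **Lemma (`lem-cyclic-mdata`(1) / Theorem `thm-nonneg-app-constant 2`(1)).**
Every m-data `(m, a, ν)` on a finite nonempty set admits a map `s : I → ℤ` such that the
conjugate m-data `s(m, a, ν) = (sm, sa, ν)`, where `(sa)(i) = a(i) + s(i) − s(ν(i))`,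
is of floor type; in particular every m-data is conjugate to an almost constant m-data. -/
theorem stmt_7 {I : Type*} [Fintype I] [Nonempty I]
    (m : I → I → ℤ) (a : I → ℤ) (ν : Equiv.Perm I) (aav : ℚ)
    (hcompat : MCompat m a ν) (havg : OrbitAvg a ν aav) :
    ∃ s : I → ℤ,
      IsFloorType (fun i => a i + s i - s (ν i)) ν aav ∧
      AlmostConstant (fun i => a i + s i - s (ν i)) := by
  let r : I → I := fun i => (Quotient.mk (Equiv.Perm.SameCycle.setoid ν) i).out
  have hr (i : I) : ν.SameCycle (r i) i :=
    Quotient.exact (s := Equiv.Perm.SameCycle.setoid ν) (Quotient.out_eq _)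
  have hr_eq {i j : I} (h : ν.SameCycle i j) : r i = r j :=
    congrArg Quotient.out (Quotient.sound (s := Equiv.Perm.SameCycle.setoid ν) h)
  choose κ hκ using fun i => (hr i).exists_nat_pow_eq
  let s : I → ℤ := fun i => floorDiscrepancy a ν aav (r i) (κ i)
  have hs (i : I) (k : ℕ) :
      s ((ν ^ k) (r i)) = floorDiscrepancy a ν aav (r i) k := by
    have hrr : r ((ν ^ k) (r i)) = r i :=
      hr_eq (Equiv.Perm.sameCycle_pow_left.2 (hr i))
    have hpow := hκ ((ν ^ k) (r i))
    rw [hrr] at hpow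
    simp only [s, hrr]
    exact floorDiscrepancy_eq_of_pow_eq havg hpow
  have hconj (i : I) (k : ℕ) :
      a ((ν ^ k) (r i)) + s ((ν ^ k) (r i)) - s (ν ((ν ^ k) (r i))) =
        ⌊((k : ℚ) + 1) * aav⌋ - ⌊(k : ℚ) * aav⌋ := by
    rw [← Equiv.Perm.mul_apply, ← pow_succ', hs, hs]
    simp only [floorDiscrepancy, Finset.sum_range_succ]
    push_cast
    ring
  refine ⟨s, fun i => ⟨r i, (hr i).symm, fun k _ => hconj i k⟩, ⌊aav⌋, fun i => ?_⟩
  have h := hconj i (κ i)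
  rw [hκ] at h
  simp only [h]
  exact floor_succ_mul_sub_floor_mul aav (κ i)
end

section
/- Let (m, a, ν) be an m-data of floor type on a finite nonempty set I, with common orbit average a_av, and write a_av = r/g with r ∈ ℤ, g ≥ 1 and gcd(r, g) = 1. Then a(ν^g(i)) = a(i) for all i ∈ I and m(ν^g(i), ν^g(j)) = m(i, j) for all i, j ∈ I. -/
theorem orbitFinset_eq_of_sameCycle {I : Type*} [Fintype I] {ν : Equiv.Perm I} {i j : I}
    (h : ν.SameCycle i j) : orbitFinset ν i = orbitFinset ν j := by
  ext x
  simp only [orbitFinset, Set.Finite.mem_toFinset, Set.mem_ofPred_eq]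
  exact ⟨fun hx => h.symm.trans hx, fun hx => h.trans hx⟩

theorem card_orbitFinset {I : Type*} [Fintype I] (ν : Equiv.Perm I) (i : I) :
    (orbitFinset ν i).card = Function.minimalPeriod ν i := by
  classical
  have h := MulAction.minimalPeriod_eq_card (a := ν) (b := i)
  have hset : (orbitFinset ν i : Set I) = MulAction.orbit (Subgroup.zpowers ν) i := by
    ext x
    simp only [orbitFinset, Set.Finite.coe_toFinset, Set.mem_ofPred_eq, MulAction.mem_orbit_iff,
      Equiv.Perm.SameCycle]
    constructor
    · rintro ⟨k, hk⟩
      exact ⟨⟨ν ^ k, k, rfl⟩, hk⟩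
    · rintro ⟨⟨_, k, rfl⟩, hk⟩
      exact ⟨k, hk⟩
  rw [← Set.ncard_coe_finset, hset, ← Nat.card_coe_set_eq, Nat.card_eq_fintype_card, ← h]
  rfl

theorem pow_card_orbitFinset_apply {I : Type*} [Fintype I] (ν : Equiv.Perm I) (i : I) :
    (ν ^ (orbitFinset ν i).card) i = i := by
  rw [card_orbitFinset, ← Equiv.Perm.iterate_eq_pow]
  exact Function.iterate_minimalPeriod

theorem card_orbitFinset_pos {I : Type*} [Fintype I] (ν : Equiv.Perm I) (i : I) :
    0 < (orbitFinset ν i).card :=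
  Finset.card_pos.mpr ⟨i, by simpa [orbitFinset] using Equiv.Perm.SameCycle.refl ν i⟩

theorem OrbitAvg.dvd_card {I : Type*} [Fintype I] {a : I → ℤ} {ν : Equiv.Perm I} {r : ℤ} {g : ℕ}
    (havg : OrbitAvg a ν ((r : ℚ) / g)) (hg : 1 ≤ g) (hcop : Int.gcd r (g : ℤ) = 1) (i : I) :
    g ∣ (orbitFinset ν i).card := by
  have hg0 : (g : ℚ) ≠ 0 := by positivity
  have h := havg i
  rw [div_mul_eq_mul_div, eq_div_iff hg0] at h
  have h' : (∑ j ∈ orbitFinset ν i, a j) * (g : ℤ) = r * ((orbitFinset ν i).card : ℤ) := by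
    exact_mod_cast h
  have hdvd : (g : ℤ) ∣ r * ((orbitFinset ν i).card : ℤ) := ⟨_, by rw [← h', mul_comm]⟩
  exact Int.natCast_dvd_natCast.mp
    (Int.dvd_of_dvd_mul_right_of_gcd_one hdvd (by rwa [Int.gcd_comm]))

theorem floor_natCast_add_mul_div (r : ℤ) {g : ℕ} (hg : 1 ≤ g) (k : ℕ) :
    ⌊((k + g : ℕ) : ℚ) * ((r : ℚ) / g)⌋ = ⌊(k : ℚ) * ((r : ℚ) / g)⌋ + r := by
  have hg0 : (g : ℚ) ≠ 0 := by positivity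
  rw [← Int.floor_add_intCast]
  congr 1
  push_cast
  field_simp

theorem periodic_floor_sub_floor (r : ℤ) {g : ℕ} (hg : 1 ≤ g) :
    Function.Periodic
      (fun k : ℕ => ⌊((k + 1 : ℕ) : ℚ) * ((r : ℚ) / g)⌋ - ⌊(k : ℚ) * ((r : ℚ) / g)⌋) g := by
  intro k
  simp only
  rw [add_right_comm, floor_natCast_add_mul_div r hg, floor_natCast_add_mul_div r hg]
  ring

/-- For an m-data of floor type, the values of `a` along the forward `ν`-orbit of any point are
given, for all exponents, by a shift of the floor formula. -/
theorem IsFloorType.exists_shift {I : Type*} [Fintype I] {a : I → ℤ} {ν : Equiv.Perm I}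
    {r : ℤ} {g : ℕ} (hfloor : IsFloorType a ν ((r : ℚ) / g))
    (havg : OrbitAvg a ν ((r : ℚ) / g)) (hg : 1 ≤ g) (hcop : Int.gcd r (g : ℤ) = 1) (i : I) :
    ∃ s : ℕ, ∀ k : ℕ, a ((ν ^ k) i) =
      ⌊((s + k + 1 : ℕ) : ℚ) * ((r : ℚ) / g)⌋ - ⌊((s + k : ℕ) : ℚ) * ((r : ℚ) / g)⌋ := by
  obtain ⟨i₀, hsame, hi₀⟩ := hfloor i
  obtain ⟨q, hq⟩ := havg.dvd_card hg hcop i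
  have hpos := card_orbitFinset_pos ν i
  have hfix : (ν ^ (orbitFinset ν i).card) i₀ = i₀ := by
    rw [orbitFinset_eq_of_sameCycle hsame]
    exact pow_card_orbitFinset_apply ν i₀
  have hper := (periodic_floor_sub_floor r hg).nat_mul q
  rw [Nat.cast_id, mul_comm, ← hq] at hper
  obtain ⟨s, hs⟩ := hsame.symm.exists_nat_pow_eq
  refine ⟨s, fun k => ?_⟩
  have hmod : (ν ^ k) i = (ν ^ ((s + k) % (orbitFinset ν i).card)) i₀ := by
    conv_lhs => rw [← hs, ← Equiv.Perm.mul_apply, ← pow_add, add_comm k s]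
    simp only [← Equiv.Perm.iterate_eq_pow] at hfix ⊢
    exact (Function.IsPeriodicPt.iterate_mod_apply hfix _).symm
  rw [hmod, hi₀ _ (Nat.mod_lt _ hpos)]
  have := hper.map_mod_nat (s + k)
  simpa only [Nat.cast_add, Nat.cast_one] using this

theorem MCompat.pow_apply {I : Type*} {m : I → I → ℤ} {a : I → ℤ} {ν : Equiv.Perm I}
    (h : MCompat m a ν) (n : ℕ) (i j : I) :
    m ((ν ^ n) i) ((ν ^ n) j) = m i j - ∑ k ∈ Finset.range n, a ((ν ^ k) i)
      + ∑ k ∈ Finset.range n, a ((ν ^ k) j) := by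
  induction n with
  | zero => simp
  | succ n ih =>
    rw [pow_succ', Equiv.Perm.mul_apply, Equiv.Perm.mul_apply, h, ih, Finset.sum_range_succ,
      Finset.sum_range_succ]
    ring

/-- **Lemma (`lem-cyclic-mdata`(2)).**  Let `(m, a, ν)` be an m-data of floor type with
common orbit average `a_av = r/g`, where `gcd(r, g) = 1` and `g ≥ 1`.  Then
`a ∘ ν^g = a` and `m(ν^g(i), ν^g(j)) = m(i, j)` for all `i, j`. -/
theorem stmt_8 {I : Type*} [Fintype I] [Nonempty I]
    (m : I → I → ℤ) (a : I → ℤ) (ν : Equiv.Perm I) (aav : ℚ)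
    (hcompat : MCompat m a ν) (havg : OrbitAvg a ν aav)
    (hfloor : IsFloorType a ν aav)
    (r : ℤ) (g : ℕ) (hg : 1 ≤ g) (hcop : Int.gcd r (g : ℤ) = 1)
    (haav : aav = (r : ℚ) / (g : ℚ)) :
    (∀ i : I, a ((ν ^ g) i) = a i) ∧
    (∀ i j : I, m ((ν ^ g) i) ((ν ^ g) j) = m i j) := by
  subst haav
  have hsum : ∀ i : I, ∑ k ∈ Finset.range g, a ((ν ^ k) i) = r := by
    intro i
    obtain ⟨s, hs⟩ := hfloor.exists_shift havg hg hcop i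
    simp only [hs, add_assoc]
    rw [Finset.sum_range_sub (fun k => ⌊((s + k : ℕ) : ℚ) * ((r : ℚ) / g)⌋),
      floor_natCast_add_mul_div r hg, add_zero]
    ring
  refine ⟨fun i => ?_, fun i j => ?_⟩
  · obtain ⟨s, hs⟩ := hfloor.exists_shift havg hg hcop i
    have h0 := hs 0
    rw [pow_zero, Equiv.Perm.one_apply, add_zero] at h0
    rw [hs g, h0]
    exact periodic_floor_sub_floor r hg s
  · rw [hcompat.pow_apply, hsum, hsum]
    ring
end

section
/- Let (m, a, ν) be an m-data on a finite nonempty set I such that m is Σ-non-negative. Then there exists s : I → ℤ such that the conjugate m-data (sm, sa, ν) is both non-negative (i.e. (sm)(i, j) ≥ 0 for all i, j ∈ I) and almost constant (i.e. there exists ℓ ∈ ℤ with (sa)(i) ∈ {ℓ, ℓ+1} for all i ∈ I). -/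
open Finset in
/-- A path of a Σ-non-negative `m` from `p 0` to `p n`, closed up to a cycle, has non-negative
weight. -/
lemma SigmaNonneg.path_add_nonneg {I : Type*} {m : I → I → ℤ} (h : SigmaNonneg m)
    (p : ℕ → I) (n : ℕ) :
    0 ≤ ∑ k ∈ range n, m (p k) (p (k + 1)) + m (p n) (p 0) := by
  have h1 := h (n + 1) n.succ_pos (fun k => p k)
  unfold cyclicSum at h1
  rw [Fin.sum_univ_eq_sum_range (fun k => m (p k) (p ((k + 1) % (n + 1)))), sum_range_succ,
    Nat.mod_self] at h1
  convert h1 using 2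
  refine sum_congr rfl fun k hk => ?_
  rw [Nat.mod_eq_of_lt (Nat.succ_lt_succ (mem_range.1 hk))]

open Finset in
/-- A Σ-non-negative `m` has a potential: the shortest path weight from a base point. -/
lemma SigmaNonneg.exists_potential {I : Type*} [Nonempty I] {m : I → I → ℤ}
    (h : SigmaNonneg m) : ∃ s : I → ℤ, ∀ i j, s j ≤ s i + m i j := by
  obtain ⟨x⟩ := ‹Nonempty I›
  let D (j : I) : Set ℤ :=
    {w | ∃ (n : ℕ) (p : ℕ → I), p 0 = x ∧ p n = j ∧ ∑ k ∈ range n, m (p k) (p (k + 1)) = w}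
  have hbdd (j : I) : BddBelow (D j) := by
    refine ⟨-m j x, ?_⟩
    rintro w ⟨n, p, h0, hn, rfl⟩
    have := h.path_add_nonneg p n
    rw [h0, hn] at this
    linarith
  have hext (i j : I) (w : ℤ) (hw : w ∈ D i) : w + m i j ∈ D j := by
    obtain ⟨n, p, h0, hn, rfl⟩ := hw
    refine ⟨n + 1, Function.update p (n + 1) j, ?_, by simp, ?_⟩
    · rw [Function.update_of_ne (by omega), h0]
    · rw [sum_range_succ, Function.update_self, Function.update_of_ne (by omega), hn]
      congr 1
      refine sum_congr rfl fun k hk => ?_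
      have := mem_range.1 hk
      rw [Function.update_of_ne (by omega), Function.update_of_ne (by omega)]
  have hne (j : I) : (D j).Nonempty := by
    refine ⟨_, hext x j 0 ⟨0, fun _ => x, rfl, rfl, by simp⟩⟩
  exact ⟨fun j => sInf (D j), fun i j =>
    csInf_le (hbdd j) (hext i j _ (Int.csInf_mem (hne i) (hbdd i)))⟩

open Finset in
/-- If `ν ^ N = 1`, then the sum of `a` along `N` steps of `ν` is `N` times the orbit average. -/
lemma OrbitAvg.sum_range_pow {I : Type*} [Fintype I] {a : I → ℤ} {ν : Equiv.Perm I} {aav : ℚ}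
    (h : OrbitAvg a ν aav) {N : ℕ} (hN : ν ^ N = 1) (i : I) :
    ∑ l ∈ range N, (a ((ν ^ l) i) : ℚ) = N * aav := by
  classical
  let g (j : I) : ℚ := ∑ l ∈ range N, (a ((ν ^ l) j) : ℚ)
  have mem (j : I) : j ∈ orbitFinset ν i ↔ ν.SameCycle i j := by simp [orbitFinset]
  have hg (j : I) : g (ν j) = g j := by
    have h1 : ∑ l ∈ range N, (a ((ν ^ (l + 1)) j) : ℚ) = g j := by
      have := (sum_range_succ (fun l => (a ((ν ^ l) j) : ℚ)) N).symm.trans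
        (sum_range_succ' (fun l => (a ((ν ^ l) j) : ℚ)) N)
      simp only [hN, pow_zero] at this
      exact (add_right_cancel this).symm
    rw [← h1]
    simp [g, pow_succ]
  have hgz (z : ℤ) : ∀ j, g ((ν ^ z) j) = g j := by
    induction z with
    | zero => simp
    | succ n ih => intro j; rw [zpow_add_one, Equiv.Perm.mul_apply, ih, hg]
    | pred n ih =>
      intro j
      rw [zpow_sub_one, Equiv.Perm.mul_apply, ih, ← hg (ν⁻¹ j), ← Equiv.Perm.mul_apply,
        mul_inv_cancel, Equiv.Perm.one_apply]
  have h1 : ∑ j ∈ orbitFinset ν i, g j = #(orbitFinset ν i) * g i := by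
    rw [← nsmul_eq_mul]
    refine sum_eq_card_nsmul fun j hj => ?_
    obtain ⟨z, rfl⟩ := (mem j).1 hj
    exact hgz z i
  have h2 : ∑ j ∈ orbitFinset ν i, g j = N * (aav * #(orbitFinset ν i)) := by
    rw [sum_comm, ← nsmul_eq_mul]
    nth_rw 2 [← card_range N]
    refine sum_eq_card_nsmul fun l _ => ?_
    rw [← h i, Int.cast_sum]
    refine sum_equiv (ν ^ l) (fun j => ?_) fun _ _ => rfl
    rw [mem, mem, Equiv.Perm.sameCycle_pow_right]
  have hpos : (#(orbitFinset ν i) : ℚ) ≠ 0 :=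
    Nat.cast_ne_zero.2 (card_ne_zero_of_mem ((mem i).2 (Equiv.Perm.SameCycle.refl ν i)))
  refine mul_left_cancel₀ hpos ?_
  change _ * g i = _
  rw [← h1, h2]
  ring

open Finset in
lemma MCompat.pow {I : Type*} {m : I → I → ℤ} {a : I → ℤ} {ν : Equiv.Perm I}
    (h : MCompat m a ν) (k : ℕ) (i j : I) :
    m ((ν ^ k) i) ((ν ^ k) j) =
      m i j - ∑ l ∈ range k, a ((ν ^ l) i) + ∑ l ∈ range k, a ((ν ^ l) j) := by
  induction k with
  | zero => simp
  | succ k ih =>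
    rw [pow_succ', Equiv.Perm.mul_apply, Equiv.Perm.mul_apply, h, ih, sum_range_succ,
      sum_range_succ]
    ring

open Finset in
/-- Averaging a potential over the powers of `ν` makes the conjugate of `a` constant. -/
lemma exists_rat_potential {I : Type*} [Fintype I] {m : I → I → ℤ} {a : I → ℤ}
    {ν : Equiv.Perm I} {aav : ℚ} (hcompat : MCompat m a ν) (havg : OrbitAvg a ν aav)
    {s : I → ℤ} (hs : ∀ i j, s j ≤ s i + m i j) :
    ∃ t : I → ℚ, (∀ i j, t j ≤ t i + m i j) ∧ ∀ i, t (ν i) = t i + a i - aav := by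
  let N := orderOf ν
  have hN : (0 : ℚ) < N := Nat.cast_pos.2 (orderOf_pos ν)
  let f (i : I) (k : ℕ) : ℚ := s ((ν ^ k) i) - ∑ l ∈ range k, (a ((ν ^ l) i) : ℚ) + k * aav
  have hle (i j : I) (k : ℕ) : f j k ≤ f i k + m i j := by
    have h1 := hs ((ν ^ k) i) ((ν ^ k) j)
    rw [hcompat.pow] at h1
    have h2 : (s ((ν ^ k) j) : ℚ) ≤ s ((ν ^ k) i) +
        (m i j - ∑ l ∈ range k, (a ((ν ^ l) i) : ℚ) + ∑ l ∈ range k, (a ((ν ^ l) j) : ℚ)) := by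
      exact_mod_cast h1
    simp only [f]
    linarith
  have hstep (i : I) (k : ℕ) : f (ν i) k = f i (k + 1) + (a i - aav) := by
    simp only [f, sum_range_succ' _ k, ← Equiv.Perm.mul_apply, ← pow_succ]
    push_cast
    simp
    ring
  have hper (i : I) : f i N = f i 0 := by
    simp [f, havg.sum_range_pow (pow_orderOf_eq_one ν), N, pow_orderOf_eq_one]
  refine ⟨fun i => (∑ k ∈ range N, f i k) / N, fun i j => ?_, fun i => ?_⟩
  · rw [div_add' _ _ _ hN.ne']
    refine (div_le_div_iff_of_pos_right hN).2 ?_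
    calc ∑ k ∈ range N, f j k ≤ ∑ k ∈ range N, (f i k + m i j) := sum_le_sum fun k _ => hle i j k
      _ = _ := by rw [sum_add_distrib]; simp [mul_comm]
  · have h1 : ∑ k ∈ range N, f i (k + 1) = ∑ k ∈ range N, f i k := by
      have := (sum_range_succ (f i) N).symm.trans (sum_range_succ' (f i) N)
      rw [hper] at this
      exact (add_right_cancel this).symm
    simp only [hstep, sum_add_distrib, h1, sum_const, card_range, nsmul_eq_mul]
    field_simp
    ring

/-- **Theorem (`thm-nonneg-app-constant`(2)).**  Let `(m, a, ν)` be an m-data on a finite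
nonempty set `I` such that `m` is Σ-non-negative.  Then there is `s : I → ℤ` such that the
conjugate m-data `(sm, sa, ν)` is non-negative and almost constant, i.e.
`m(i,j) + s(i) − s(j) ≥ 0` for all `i, j` and the family `(a(i) + s(i) − s(ν(i)))_i`
is almost constant. -/
theorem stmt_9 {I : Type*} [Fintype I] [Nonempty I]
    (m : I → I → ℤ) (a : I → ℤ) (ν : Equiv.Perm I) (aav : ℚ)
    (hcompat : MCompat m a ν) (havg : OrbitAvg a ν aav)
    (hnn : SigmaNonneg m) :
    ∃ s : I → ℤ,
      (∀ i j : I, 0 ≤ m i j + s i - s j) ∧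
      AlmostConstant (fun i => a i + s i - s (ν i)) := by
  obtain ⟨s, hs⟩ := hnn.exists_potential
  obtain ⟨t, ht, hν⟩ := exists_rat_potential hcompat havg hs
  refine ⟨fun i => ⌊t i⌋, fun i j => ?_, ⌊aav⌋, fun i => ?_⟩
  · have h1 := Int.floor_mono (ht i j)
    rw [Int.floor_add_intCast] at h1
    linarith
  · have h1 : ⌊t (ν i)⌋ = ⌊t i - aav⌋ + a i := by
      rw [hν, ← Int.floor_add_intCast]
      congr 1
      ring
    have h2 := Int.le_floor_add (t i - aav) aav
    have h3 := Int.le_floor_add_floor (t i - aav) aav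
    rw [sub_add_cancel] at h2 h3
    simp only [h1]
    omega
end

section
/- Let I be a finite nonempty set, ν a permutation of I, and H ⊆ I × I a subset with ν(H) = H, where ν acts on I × I by ν(i, j) := (ν(i), ν(j)). Let a : I → ℤ be such that there exists a_av ∈ ℚ with Σ_{i∈I'} a(i) = a_av · #I' for every ν-orbit I' ⊆ I, and let m : H → ℤ satisfy m(ν(i), ν(j)) = m(i, j) − a(i) + a(j) for all (i, j) ∈ H. Then for every N ∈ ℤ there exists a map m' : I × I → ℤ such that: (1) m'(i, j) = m(i, j) for all (i, j) ∈ H; (2) m'(ν(i), ν(j)) = m'(i, j) − a(i) + a(j) for all (i, j) ∈ I × I; (3) m'(i, j) ≥ N for all (i, j) ∈ (I × I) \ H. -/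
open Finset Function in
/-- The orbit of `x` is listed without repetition by the iterates below the minimal period. -/
theorem sum_orbitFinset {I M : Type*} [Fintype I] [AddCommMonoid M]
    (ν : Equiv.Perm I) (x : I) (f : I → M) :
    ∑ j ∈ orbitFinset ν x, f j = ∑ k ∈ range (minimalPeriod ν x), f (ν^[k] x) := by
  symm
  have hx : x ∈ periodicPts ν := ν.injective.mem_periodicPts x
  refine Finset.sum_bij (fun k _ => ν^[k] x) ?_ ?_ ?_ (fun _ _ => rfl)
  · intro k _
    simp only [orbitFinset, Set.Finite.mem_toFinset, Set.mem_ofPred_eq]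
    exact ⟨k, by simp [← Equiv.Perm.iterate_eq_pow]⟩
  · intro k hk l hl h
    exact iterate_injOn_Iio_minimalPeriod (by simpa using hk) (by simpa using hl) h
  · intro y hy
    simp only [orbitFinset, Set.Finite.mem_toFinset, Set.mem_ofPred_eq] at hy
    obtain ⟨k, hk⟩ := hy.exists_nat_pow_eq
    refine ⟨k % minimalPeriod ν x,
      mem_range.2 (Nat.mod_lt _ (minimalPeriod_pos_of_mem_periodicPts hx)), ?_⟩
    rw [iterate_mod_minimalPeriod_eq, Equiv.Perm.iterate_eq_pow, hk]

open Finset Function in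
/-- A rational function on a finite set whose sums over the orbits of `ν` vanish is a
coboundary. -/
theorem exists_coboundary {I : Type*} [Fintype I] (ν : Equiv.Perm I) (f : I → ℚ)
    (hf : ∀ i, ∑ j ∈ orbitFinset ν i, f j = 0) :
    ∃ g : I → ℚ, ∀ i, g (ν i) = g i + f i := by
  refine ⟨fun i => (∑ k ∈ range (minimalPeriod ν i), (k : ℚ) * f (ν^[k] i)) /
    minimalPeriod ν i, fun i => ?_⟩
  have hi : i ∈ periodicPts ν := ν.injective.mem_periodicPts i
  have hpos := minimalPeriod_pos_of_mem_periodicPts hi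
  have hper : ν^[minimalPeriod ν i] i = i := iterate_minimalPeriod
  have hsum := hf i
  rw [sum_orbitFinset] at hsum
  simp only [minimalPeriod_apply hi]
  generalize minimalPeriod ν i = n at *
  have hn : (n : ℚ) ≠ 0 := by exact_mod_cast hpos.ne'
  have h1 := sum_range_succ (fun k => (k : ℚ) * f (ν^[k] i)) n
  rw [sum_range_succ'] at h1
  have h2 := sum_range_succ (fun k => f (ν^[k] i)) n
  rw [sum_range_succ'] at h2
  simp only [hper, hsum, iterate_succ_apply, Nat.cast_add, Nat.cast_one, add_mul, one_mul,
    sum_add_distrib, Nat.cast_zero, zero_mul, add_zero, iterate_zero, id] at h1 h2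
  field_simp
  linarith

/-- **Example (`extend to m-data`).**  Let `I` be a finite nonempty set, `ν` a permutation
of `I`, `H ⊆ I × I` a `ν`-stable subset, `a : I → ℤ` with constant orbit averages `a_av`, and
`m : H → ℤ` satisfying `m(ν(i), ν(j)) = m(i, j) − a(i) + a(j)` on `H`.  Then for every
`N ∈ ℤ` the map `m` extends to `m' : I × I → ℤ` satisfying the same compatibility on all of
`I × I` and with `m'(i, j) ≥ N` outside `H`. -/
theorem stmt_10 {I : Type*} [Fintype I] [Nonempty I]
    (ν : Equiv.Perm I) (H : Set (I × I))
    (hH : (fun p : I × I => (ν p.1, ν p.2)) '' H = H)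
    (a : I → ℤ) (aav : ℚ) (havg : OrbitAvg a ν aav)
    (m : H → ℤ)
    (hcompat : ∀ (p : I × I) (hp : p ∈ H) (hp' : (ν p.1, ν p.2) ∈ H),
      m ⟨(ν p.1, ν p.2), hp'⟩ = m ⟨p, hp⟩ - a p.1 + a p.2)
    (N : ℤ) :
    ∃ m' : I × I → ℤ,
      (∀ (p : I × I) (hp : p ∈ H), m' p = m ⟨p, hp⟩) ∧
      (∀ p : I × I, m' (ν p.1, ν p.2) = m' p - a p.1 + a p.2) ∧
      (∀ p : I × I, p ∉ H → N ≤ m' p) := by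
  classical
  obtain ⟨b, hb⟩ := exists_coboundary ν (fun i => aav - a i) (fun i => by
    have h := havg i
    push_cast at h
    rw [Finset.sum_sub_distrib, h, Finset.sum_const, nsmul_eq_mul]
    ring)
  have hmem : ∀ p : I × I, (ν p.1, ν p.2) ∈ H ↔ p ∈ H := by
    intro p
    constructor
    · intro hp
      rw [← hH] at hp
      obtain ⟨q, hq, h⟩ := hp
      have hqp : q = p :=
        Prod.ext (ν.injective (congrArg Prod.fst h)) (ν.injective (congrArg Prod.snd h))
      exact hqp ▸ hq
    · intro hp
      rw [← hH]
      exact ⟨p, hp, rfl⟩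
  obtain ⟨B, hB⟩ := (Set.finite_range fun p : I × I => ⌊b p.1 - b p.2⌋).bddBelow
  refine ⟨fun p => if hp : p ∈ H then m ⟨p, hp⟩ else ⌊b p.1 - b p.2⌋ + (N - B), ?_, ?_, ?_⟩
  · intro p hp
    simp [hp]
  · intro p
    by_cases hp : p ∈ H
    · have hp' := (hmem p).2 hp
      simp only [hp, hp', dite_true]
      exact hcompat p hp hp'
    · have hp' := mt (hmem p).1 hp
      simp only [hp, hp', dite_false]
      have h : b (ν p.1) - b (ν p.2) = b p.1 - b p.2 + ((a p.2 - a p.1 : ℤ) : ℚ) := by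
        rw [hb, hb]
        push_cast
        ring
      rw [h, Int.floor_add_intCast]
      ring
  · intro p hp
    have h := hB (Set.mem_range_self p)
    simp only [hp, dite_false]
    linarith
end

section
/- Let 𝒯 be a triangulated category and 𝒜, ℬ, 𝒞, 𝒟 thick subcategories of 𝒯. Suppose that every object of 𝒯 lies in 𝒜 * ℬ and also in 𝒞 * 𝒟 (i.e. 𝒯 = 𝒜 * ℬ = 𝒞 * 𝒟), and that 𝒜 ⊆ 𝒞 and 𝒟 ⊆ ℬ. Then every object of 𝒯 lies in (𝒜 * (ℬ ∩ 𝒞)) * 𝒟, i.e. 𝒯 = 𝒜 * (ℬ ∩ 𝒞) * 𝒟. -/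
open CategoryTheory Limits Pretriangulated

universe v u

variable (C : Type u) [Category.{v} C] [HasZeroObject C] [HasShift C ℤ] [Preadditive C]
  [∀ n : ℤ, (CategoryTheory.shiftFunctor C n).Additive] [Pretriangulated C]

/-- A thick subcategory of a (pre)triangulated category, given by a predicate on objects
which is closed under isomorphisms, the shifts `[1]` and `[−1]`, cones
(i.e. for a distinguished triangle `X → Z → Y → X[1]` with `X, Y` in it, `Z` is in it),
and direct summands (retracts). -/
structure ThickSubcat where
  P : C → Prop
  iso_closed : ∀ {X Y : C}, (X ≅ Y) → P X → P Y
  shift_closed : ∀ X : C, P X → P (X⟦(1 : ℤ)⟧)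
  neg_shift_closed : ∀ X : C, P X → P (X⟦(-1 : ℤ)⟧)
  ext_closed : ∀ T : Triangle C, T ∈ (distTriang C) → P T.obj₁ → P T.obj₃ → P T.obj₂
  summand_closed : ∀ {X Y : C} (i : X ⟶ Y) (r : Y ⟶ X), i ≫ r = 𝟙 X → P Y → P X

variable {C}

/-- `(𝒳 * 𝒴)(Z)` holds iff there is a distinguished triangle `X → Z → Y → X[1]`
with `X ∈ 𝒳` and `Y ∈ 𝒴`. -/
def starSubcat (A B : C → Prop) : C → Prop := fun Z =>
  ∃ (X Y : C) (f : X ⟶ Z) (g : Z ⟶ Y) (h : Y ⟶ X⟦(1 : ℤ)⟧),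
    Triangle.mk f g h ∈ (distTriang C) ∧ A X ∧ B Y

/-- **Lemma (`distributive`(2)).**  Let `𝒯` be a triangulated category and `𝒜, ℬ, 𝒞, 𝒟`
thick subcategories with `𝒯 = 𝒜 * ℬ = 𝒞 * 𝒟`, `𝒜 ⊆ 𝒞` and `𝒟 ⊆ ℬ`.  Then
`𝒯 = 𝒜 * (ℬ ∩ 𝒞) * 𝒟`. -/
theorem stmt_12 [IsTriangulated C] (𝒜 ℬ 𝒞 𝒟 : ThickSubcat C)
    (h₁ : ∀ Z : C, starSubcat 𝒜.P ℬ.P Z)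
    (h₂ : ∀ Z : C, starSubcat 𝒞.P 𝒟.P Z)
    (hAC : ∀ X : C, 𝒜.P X → 𝒞.P X)
    (hDB : ∀ X : C, 𝒟.P X → ℬ.P X) :
    ∀ Z : C, starSubcat (starSubcat 𝒜.P (fun W => ℬ.P W ∧ 𝒞.P W)) 𝒟.P Z := by
  intro Z
  obtain ⟨X, Y, f, g, h, hT, hX, hY⟩ := h₂ Z
  obtain ⟨A, B, f', g', h', hT', hA, hB⟩ := h₁ X
  have hBC : 𝒞.P B :=
    𝒞.ext_closed _ (rot_of_distTriang _ hT') hX (𝒞.shift_closed _ (hAC _ hA))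
  exact ⟨X, Y, f, g, h, hT, ⟨A, B, f', g', h', hT', hA, hB, hBC⟩, hY⟩
end

section
/- Let 𝒯 be a triangulated category and 𝒜, ℬ, 𝒞, 𝒟 thick subcategories of 𝒯 such that 𝒜 ⊆ 𝒞 ⊆ 𝒜 * ℬ and ℬ ⊆ 𝒟 ⊆ 𝒜 * ℬ. Then 𝒞 ∩ 𝒟 = (𝒜 ∩ 𝒟) * (ℬ ∩ 𝒞). -/
open CategoryTheory Limits Pretriangulated

universe v u

variable (C : Type u) [Category.{v} C] [HasZeroObject C] [HasShift C ℤ] [Preadditive C]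
  [∀ n : ℤ, (CategoryTheory.shiftFunctor C n).Additive] [Pretriangulated C]

variable {C}

/-- **Lemma (`distributive`(3)).**  Let `𝒯` be a triangulated category and `𝒜, ℬ, 𝒞, 𝒟`
thick subcategories with `𝒜 ⊆ 𝒞 ⊆ 𝒜 * ℬ` and `ℬ ⊆ 𝒟 ⊆ 𝒜 * ℬ`.  Then
`𝒞 ∩ 𝒟 = (𝒜 ∩ 𝒟) * (ℬ ∩ 𝒞)`. -/
theorem stmt_13 [IsTriangulated C] (𝒜 ℬ 𝒞 𝒟 : ThickSubcat C)
    (hAC : ∀ X : C, 𝒜.P X → 𝒞.P X)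
    (hCAB : ∀ X : C, 𝒞.P X → starSubcat 𝒜.P ℬ.P X)
    (hBD : ∀ X : C, ℬ.P X → 𝒟.P X)
    (hDAB : ∀ X : C, 𝒟.P X → starSubcat 𝒜.P ℬ.P X) :
    ∀ Z : C, (𝒞.P Z ∧ 𝒟.P Z) ↔
      starSubcat (fun W => 𝒜.P W ∧ 𝒟.P W) (fun W => ℬ.P W ∧ 𝒞.P W) Z := by
  intro Z
  constructor
  · rintro ⟨hC, hD⟩
    obtain ⟨X, Y, f, g, h, hT, hX, hY⟩ := hCAB Z hC
    have hXD : 𝒟.P X := 𝒟.ext_closed _ (inv_rot_of_distTriang _ hT)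
      (𝒟.neg_shift_closed Y (hBD Y hY)) hD
    have hYC : 𝒞.P Y := 𝒞.ext_closed _ (rot_of_distTriang _ hT)
      hC (𝒞.shift_closed X (hAC X hX))
    exact ⟨X, Y, f, g, h, hT, ⟨hX, hXD⟩, ⟨hY, hYC⟩⟩
  · rintro ⟨X, Y, f, g, h, hT, ⟨hXA, hXD⟩, ⟨hYB, hYC⟩⟩
    exact ⟨𝒞.ext_closed _ hT (hAC X hXA) hYC, 𝒟.ext_closed _ hT hXD (hBD Y hYB)⟩
end

section
/- Let A be a ring-indecomposable locally finite ℕ-graded k-algebra over a field k. Then for any two non-isomorphic simple right A-modules S and S' concentrated in degree 0 (i.e. annihilated by A_{≥1}), there exists a finite sequence S = S⁰, S¹, …, S^ℓ = S' of simple right A-modules concentrated in degree 0 such that for each 0 ≤ i ≤ ℓ−1, either Ext¹_A(Sⁱ, S^{i+1}) ≠ 0 or Ext¹_A(S^{i+1}, Sⁱ) ≠ 0. -/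
/-- `Ext¹_A(M, N) ≠ 0`, expressed by the existence of a non-split short exact sequence
`0 → N → E → M → 0` of `A`-modules. -/
def HasNonsplitExt (A : Type) [Ring A] (M : Type) [AddCommGroup M] [Module A M]
    (N : Type) [AddCommGroup N] [Module A N] : Prop :=
  ∃ (E : ModuleCat.{0} A) (f : N →ₗ[A] E) (g : E →ₗ[A] M),
    Function.Injective f ∧ Function.Surjective g ∧
    LinearMap.range f = LinearMap.ker g ∧
    ¬ ∃ h : M →ₗ[A] E, g ∘ₗ h = LinearMap.id

section Lattice

variable {L : Type*} [Lattice L] [IsModularLattice L]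

theorem exists_relative_complement_of_split [WellFoundedLT L] [WellFoundedGT L]
    {c d : L → L → Prop}
    (hc : ∀ X Y, X ⊓ Y ⋖ X → c Y (X ⊔ Y) → c (X ⊓ Y) X)
    (hdc : ∀ U V W, U ⋖ V → V ⋖ W → d U V → c V W → ∃ V', V' ⊓ V = U ∧ V' ⊔ V = W)
    {N X : L} (hNX : N ⋖ X) (hcNX : c N X) (F : L) (hFN : F ≤ N)
    (hd : ∀ U V, F ≤ U → U ⋖ V → V ≤ N → d U V) :
    ∃ G, G ⊓ N = F ∧ G ⊔ N = X := by
  induction F using WellFoundedGT.induction with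
  | ind F ih =>
  rcases hFN.eq_or_lt with rfl | hlt
  · exact ⟨X, inf_eq_right.2 hNX.le, sup_eq_left.2 hNX.le⟩
  · obtain ⟨F₁, hF₁, hF₁N⟩ := exists_covBy_le_of_lt hlt
    obtain ⟨G₁, hinf, hsup⟩ := ih F₁ hF₁.lt hF₁N
      fun U V hU hUV hV => hd U V (hF₁.le.trans hU) hUV hV
    have hcov : G₁ ⊓ N ⋖ G₁ := inf_covBy_of_covBy_sup_right (by rwa [hsup])
    have hcG : c (G₁ ⊓ N) G₁ := hc _ _ hcov (by rwa [hsup])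
    rw [hinf] at hcov hcG
    obtain ⟨G, hG, hG'⟩ := hdc F F₁ G₁ hF₁ hcov (hd _ _ le_rfl hF₁ hF₁N) hcG
    have hGG₁ : G ≤ G₁ := hG' ▸ le_sup_left
    refine ⟨G, ?_, ?_⟩
    · rw [← hG, ← hinf, ← inf_assoc, inf_eq_left.2 hGG₁]
    · rw [← hsup, ← hG', sup_assoc, sup_eq_right.2 hF₁N]

theorem interval_le_of_covBy {c : L → L → Prop}
    (hc : ∀ X Y, X ⊓ Y ⋖ X → (c (X ⊓ Y) X ↔ c Y (X ⊔ Y)))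
    {P G : L} (hPG : P ⋖ G) (hcPG : c P G) (hP : ∀ U V, U ⋖ V → V ≤ P → c U V)
    (U V : L) (hUV : U ⋖ V) (hV : V ≤ G) : c U V := by
  by_cases h : V ⊓ P ≤ U
  · have hVP : ¬ V ≤ P := fun h' => hUV.lt.not_ge (by rwa [inf_eq_left.2 h'] at h)
    have hsup : V ⊔ P = G := (hPG.eq_or_eq le_sup_right (sup_le hV hPG.le)).resolve_left
      fun h' => hVP (h' ▸ le_sup_left)
    have hcov : V ⊓ P ⋖ V := inf_covBy_of_covBy_sup_right (by rwa [hsup])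
    have hU : V ⊓ P = U :=
      ((hcov.eq_or_eq h hUV.le).resolve_right hUV.lt.ne).symm
    rw [← hU, hc _ _ hcov, hsup]
    exact hcPG
  · have hsup : V ⊓ P ⊔ U = V :=
      (hUV.eq_or_eq le_sup_right (sup_le inf_le_left hUV.le)).resolve_left
        fun h' => h (h' ▸ le_sup_left)
    have hcov : V ⊓ P ⊓ U ⋖ V ⊓ P := inf_covBy_of_covBy_sup_right (by rwa [hsup])
    have := (hc _ _ hcov).1 (hP _ _ hcov inf_le_right)
    rwa [hsup] at this

theorem interval_sup_of_disjoint [OrderBot L] {d : L → L → Prop}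
    (hd : ∀ X Y, X ⊓ Y ⋖ X → (d (X ⊓ Y) X ↔ d Y (X ⊔ Y)))
    {P Q : L} (hQ : ∀ U V, U ⋖ V → V ≤ Q → d U V)
    (U V : L) (hU : P ≤ U) (hUV : U ⋖ V) (hV : V ≤ P ⊔ Q) : d U V := by
  have hsup : V ⊓ Q ⊔ U = V := by
    rw [inf_sup_assoc_of_le Q hUV.le, inf_eq_left]
    exact hV.trans (sup_le (hU.trans le_sup_right) le_sup_left)
  have hcov : V ⊓ Q ⊓ U ⋖ V ⊓ Q := inf_covBy_of_covBy_sup_right (by rwa [hsup])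
  have := (hd _ _ hcov).1 (hQ _ _ hcov inf_le_right)
  rwa [hsup] at this

theorem exists_extend_decomposition [OrderBot L] [WellFoundedLT L] [WellFoundedGT L]
    {c d : L → L → Prop}
    (hc : ∀ X Y, X ⊓ Y ⋖ X → (c (X ⊓ Y) X ↔ c Y (X ⊔ Y)))
    (hd : ∀ X Y, X ⊓ Y ⋖ X → (d (X ⊓ Y) X ↔ d Y (X ⊔ Y)))
    (hdc : ∀ U V W, U ⋖ V → V ⋖ W → d U V → c V W → ∃ V', V' ⊓ V = U ∧ V' ⊔ V = W)
    {P Q X : L} (hPQ : P ⊓ Q = ⊥) (hX : P ⊔ Q ⋖ X) (hcX : c (P ⊔ Q) X)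
    (hP : ∀ U V, U ⋖ V → V ≤ P → c U V) (hQ : ∀ U V, U ⋖ V → V ≤ Q → d U V) :
    ∃ G, G ⊓ Q = ⊥ ∧ G ⊔ Q = X ∧ ∀ U V, U ⋖ V → V ≤ G → c U V := by
  obtain ⟨G, hinf, hsup⟩ := exists_relative_complement_of_split
    (fun X Y h => (hc X Y h).2) hdc hX hcX P le_sup_left (interval_sup_of_disjoint hd hQ)
  have hcov : G ⊓ (P ⊔ Q) ⋖ G := inf_covBy_of_covBy_sup_right (by rwa [hsup])
  have hcG : c (G ⊓ (P ⊔ Q)) G := (hc _ _ hcov).2 (by rwa [hsup])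
  have hPG : P ≤ G := hinf ▸ inf_le_left
  rw [hinf] at hcov hcG
  refine ⟨G, ?_, ?_, interval_le_of_covBy hc hcov hcG hP⟩
  · rw [← hPQ, ← hinf, inf_assoc, inf_eq_right.2 (le_sup_right : Q ≤ P ⊔ Q)]
  · rw [← hsup, ← sup_assoc, sup_eq_left.2 hPG]

theorem exists_isCompl_of_split [BoundedOrder L] [WellFoundedLT L] [WellFoundedGT L]
    {c d : L → L → Prop}
    (hc : ∀ X Y, X ⊓ Y ⋖ X → (c (X ⊓ Y) X ↔ c Y (X ⊔ Y)))
    (hd : ∀ X Y, X ⊓ Y ⋖ X → (d (X ⊓ Y) X ↔ d Y (X ⊔ Y)))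
    (hcd : ∀ U V, U ⋖ V → c U V ∨ d U V)
    (hsplit : ∀ U V W, U ⋖ V → V ⋖ W → (d U V ∧ c V W) ∨ (c U V ∧ d V W) →
      ∃ V', V' ⊓ V = U ∧ V' ⊔ V = W) :
    ∃ P Q, IsCompl P Q ∧ (∀ U V, U ⋖ V → V ≤ P → c U V) ∧
      (∀ U V, U ⋖ V → V ≤ Q → d U V) := by
  let s : Set L := {N | ∃ P Q, P ⊓ Q = ⊥ ∧ P ⊔ Q = N ∧ (∀ U V, U ⋖ V → V ≤ P → c U V) ∧
    (∀ U V, U ⋖ V → V ≤ Q → d U V)}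
  have hs : (⊥ : L) ∈ s := ⟨⊥, ⊥, by simp, by simp,
    fun U V h hV => absurd (h.lt.trans_le hV) not_lt_bot,
    fun U V h hV => absurd (h.lt.trans_le hV) not_lt_bot⟩
  obtain ⟨N, ⟨P, Q, hPQ, rfl, hP, hQ⟩, hmax⟩ :=
    (wellFounded_gt (α := L)).has_min s ⟨⊥, hs⟩
  rcases (le_top : P ⊔ Q ≤ ⊤).eq_or_lt with htop | hlt
  · exact ⟨P, Q, ⟨disjoint_iff.2 hPQ, codisjoint_iff.2 htop⟩, hP, hQ⟩
  exfalso
  obtain ⟨X, hX, -⟩ := exists_covBy_le_of_lt hlt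
  rcases hcd _ _ hX with h | h
  · obtain ⟨G, h₁, h₂, h₃⟩ := exists_extend_decomposition hc hd
      (fun U V W hU hV h h' => hsplit U V W hU hV (.inl ⟨h, h'⟩)) hPQ hX h hP hQ
    exact hmax X ⟨G, Q, h₁, h₂, h₃, hQ⟩ hX.lt
  · rw [inf_comm] at hPQ
    rw [sup_comm] at h hX hmax
    obtain ⟨G, h₁, h₂, h₃⟩ := exists_extend_decomposition hd hc
      (fun U V W hU hV h h' => hsplit U V W hU hV (.inr ⟨h, h'⟩)) hPQ hX h hQ hP
    exact hmax X ⟨P, G, by rwa [inf_comm], by rwa [sup_comm], hP, h₃⟩ hX.lt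

end Lattice

theorem HasNonsplitExt.congr_left {B : Type} [Ring B] {M M' N : Type}
    [AddCommGroup M] [Module B M] [AddCommGroup M'] [Module B M'] [AddCommGroup N] [Module B N]
    (h : HasNonsplitExt B M N) (e : M ≃ₗ[B] M') : HasNonsplitExt B M' N := by
  obtain ⟨E, f, g, hf, hg, hfg, hs⟩ := h
  refine ⟨E, f, e.toLinearMap ∘ₗ g, hf, e.surjective.comp hg, ?_, ?_⟩
  · rw [hfg, LinearMap.ker_comp_of_ker_eq_bot _ e.ker]
  · rintro ⟨s, hs'⟩
    refine hs ⟨s ∘ₗ e.toLinearMap, LinearMap.ext fun x => e.injective ?_⟩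
    simpa using LinearMap.congr_fun hs' (e x)

theorem HasNonsplitExt.congr_right {B : Type} [Ring B] {M N N' : Type}
    [AddCommGroup M] [Module B M] [AddCommGroup N] [Module B N] [AddCommGroup N'] [Module B N']
    (h : HasNonsplitExt B M N) (e : N ≃ₗ[B] N') : HasNonsplitExt B M N' := by
  obtain ⟨E, f, g, hf, hg, hfg, hs⟩ := h
  refine ⟨E, f ∘ₗ e.symm.toLinearMap, g, hf.comp e.symm.injective, hg, ?_, hs⟩
  rw [LinearMap.range_comp_of_range_eq_top _ e.symm.range, hfg]

section Factor

variable {B : Type} [Ring B] {M M' : Type} [AddCommGroup M] [Module B M]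
  [AddCommGroup M'] [Module B M'] (C D : ModuleCat.{0} B → Prop)

/-- The subquotient `V / U` of `M` is isomorphic to a module satisfying `C`. -/
def FactorIn (U V : Submodule B M) : Prop :=
  ∃ T : ModuleCat.{0} B, C T ∧ Nonempty ((V ⧸ U.comap V.subtype) ≃ₗ[B] T)

variable {C D}

theorem factorIn_inf_iff_sup (X Y : Submodule B M) :
    FactorIn C (X ⊓ Y) X ↔ FactorIn C Y (X ⊔ Y) := by
  have e₁ := LinearMap.quotientInfEquivSupQuotient X Y
  have e₂ : (X ⧸ (X ⊓ Y).comap X.subtype) ≃ₗ[B]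
      X ⧸ X.comap X.subtype ⊓ Y.comap X.subtype :=
    Submodule.quotEquivOfEq _ _ (Submodule.comap_inf _ _ _)
  constructor
  · rintro ⟨T, hT, ⟨e⟩⟩
    exact ⟨T, hT, ⟨e₁.symm.trans (e₂.symm.trans e)⟩⟩
  · rintro ⟨T, hT, ⟨e⟩⟩
    exact ⟨T, hT, ⟨e₂.trans (e₁.trans e)⟩⟩

theorem exists_complement_of_not_hasNonsplitExt {T T' : Type} [AddCommGroup T] [Module B T]
    [AddCommGroup T'] [Module B T'] {U V W : Submodule B M} (hUV : U ≤ V) (hVW : V ≤ W)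
    (e : (V ⧸ U.comap V.subtype) ≃ₗ[B] T) (e' : (W ⧸ V.comap W.subtype) ≃ₗ[B] T')
    (h : ¬ HasNonsplitExt B T' T) : ∃ V', V' ⊓ V = U ∧ V' ⊔ V = W := by
  let i : (V ⧸ U.comap V.subtype) →ₗ[B] (W ⧸ U.comap W.subtype) :=
    Submodule.mapQ _ _ (Submodule.inclusion hVW) (fun x hx => hx)
  let p : (W ⧸ U.comap W.subtype) →ₗ[B] (W ⧸ V.comap W.subtype) :=
    Submodule.factor (Submodule.comap_mono hUV)
  have hp : ∀ w : W, p (Submodule.Quotient.mk w) = 0 ↔ (w : M) ∈ V := fun w => by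
    simp [p]
  have hi : Function.Injective i := by
    rw [← LinearMap.ker_eq_bot, LinearMap.ker_eq_bot']
    intro x
    induction x using Submodule.Quotient.induction_on with
    | H x =>
      intro hx
      replace hx := (Submodule.Quotient.mk_eq_zero _).1 hx
      exact (Submodule.Quotient.mk_eq_zero _).2 hx
  have hpsurj : Function.Surjective p := Submodule.factor_surjective _
  have hip : LinearMap.range i = LinearMap.ker p := by
    ext x
    induction x using Submodule.Quotient.induction_on with
    | H x =>
    rw [LinearMap.mem_ker, hp]
    constructor
    · rintro ⟨y, hy⟩
      induction y using Submodule.Quotient.induction_on with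
      | H y =>
      replace hy := (Submodule.Quotient.eq _).1 hy
      have := V.sub_mem y.2 (hUV hy)
      simpa using! this
    · intro hx
      exact ⟨Submodule.Quotient.mk ⟨x, hx⟩, rfl⟩
  have hsplit : ∃ s : T' →ₗ[B] (W ⧸ U.comap W.subtype),
      (e'.toLinearMap ∘ₗ p) ∘ₗ s = LinearMap.id := by
    by_contra hs
    refine h ⟨ModuleCat.of B (W ⧸ U.comap W.subtype), i ∘ₗ e.symm.toLinearMap,
      e'.toLinearMap ∘ₗ p, hi.comp e.symm.injective, e'.surjective.comp hpsurj, ?_, hs⟩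
    rw [LinearMap.range_comp_of_range_eq_top _ e.symm.range,
      LinearMap.ker_comp_of_ker_eq_bot _ e'.ker]
    exact hip
  obtain ⟨s, hs⟩ := hsplit
  have hs' : ∀ t, e' (p (s t)) = t := fun t => LinearMap.congr_fun hs t
  refine ⟨((LinearMap.range s).comap (Submodule.mkQ _)).map W.subtype, le_antisymm ?_ ?_,
    le_antisymm (sup_le (Submodule.map_subtype_le _ _) hVW) ?_⟩
  · rintro _ ⟨⟨x, ⟨t, ht⟩, rfl⟩, hxV⟩
    have ht0 : t = 0 := by
      rw [← hs' t, ht]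
      exact (congrArg e' ((hp x).2 hxV)).trans (map_zero e')
    rw [ht0, map_zero] at ht
    simpa using ht.symm
  · intro x hx
    refine ⟨⟨⟨x, hVW (hUV hx)⟩, ⟨0, ?_⟩, rfl⟩, hUV hx⟩
    rw [map_zero]
    exact ((Submodule.Quotient.mk_eq_zero (U.comap W.subtype)).2 hx).symm
  · intro w hw
    obtain ⟨w', hw'⟩ := Submodule.mkQ_surjective _
      (s (e' (p (Submodule.Quotient.mk ⟨w, hw⟩))))
    have hmem : w - w' ∈ V := by
      refine (hp (⟨w, hw⟩ - w')).1 ?_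
      apply e'.injective
      rw [Submodule.Quotient.mk_sub, map_sub, map_sub, map_zero, sub_eq_zero,
        ← Submodule.mkQ_apply _ w', hw', hs']
    have := add_mem (Submodule.mem_sup_right hmem)
      (Submodule.mem_sup_left (T := V) (Submodule.mem_map_of_mem (f := W.subtype)
        (show w' ∈ (LinearMap.range s).comap (Submodule.mkQ _) from ⟨_, hw'.symm⟩)))
    simpa using this

theorem factorIn_of_isSimpleModule {T : ModuleCat.{0} B} [IsSimpleModule B T] (hT : C T)
    (U V : Submodule B T) (hUV : U ⋖ V) : FactorIn C U V := by
  obtain rfl : V = ⊤ := (eq_bot_or_eq_top V).resolve_left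
    fun h => absurd (h ▸ hUV.lt) not_lt_bot
  obtain rfl : U = ⊥ := (eq_bot_or_eq_top U).resolve_right hUV.lt.ne
  refine ⟨T, hT, ⟨?_⟩⟩
  exact (Submodule.quotEquivOfEqBot _ (by simp)).trans Submodule.topEquiv

theorem map_eq_zero_of_factorIn [IsArtinian B M']
    (hCD : ∀ T T', C T → D T' → IsEmpty (T ≃ₗ[B] T')) (φ : M →ₗ[B] M')
    {X : Submodule B M} {Y : Submodule B M'} (hXY : ∀ x ∈ X, φ x ∈ Y)
    (hX : ∀ U V, U ⋖ V → V ≤ X → FactorIn C U V)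
    (hY : ∀ U V, U ⋖ V → V ≤ Y → FactorIn D U V) : ∀ x ∈ X, φ x = 0 := by
  by_contra! hne
  obtain ⟨x, hx, hφx⟩ := hne
  have hlt : ⊥ < X.map φ := bot_lt_iff_ne_bot.2
    ((Submodule.ne_bot_iff _).2 ⟨φ x, Submodule.mem_map_of_mem hx, hφx⟩)
  obtain ⟨V, hV, hVX⟩ := exists_covBy_le_of_lt hlt
  let X' := X ⊓ V.comap φ
  let K := X ⊓ LinearMap.ker φ
  let ψ : X' →ₗ[B] V := φ.restrict (fun y hy => hy.2)
  have hψ : Function.Surjective ψ := by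
    rintro ⟨v, hv⟩
    obtain ⟨y, hy, rfl⟩ := hVX hv
    exact ⟨⟨y, hy, hv⟩, rfl⟩
  have hker : K.comap X'.subtype = LinearMap.ker ψ := by
    ext y
    simp only [K, ψ, Submodule.mem_comap, Submodule.mem_inf, LinearMap.mem_ker,
      Submodule.subtype_apply, Subtype.ext_iff, LinearMap.coe_restrict_apply,
      ZeroMemClass.coe_zero]
    exact and_iff_right y.2.1
  have e : (X' ⧸ K.comap X'.subtype) ≃ₗ[B] V ⧸ (⊥ : Submodule B M').comap V.subtype :=
    ((Submodule.quotEquivOfEq _ _ hker).trans (ψ.quotKerEquivOfSurjective hψ)).trans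
      (Submodule.quotEquivOfEqBot _ (by simp)).symm
  have hKX : K ≤ X' := inf_le_inf_left _ fun y hy => by
    simp [LinearMap.mem_ker.1 hy]
  have := (covBy_iff_quot_is_simple bot_le).1 hV
  have hcov : K ⋖ X' := (covBy_iff_quot_is_simple hKX).2 (IsSimpleModule.congr e)
  obtain ⟨T, hT, ⟨eT⟩⟩ := hX _ _ hcov inf_le_left
  obtain ⟨T', hT', ⟨eT'⟩⟩ := hY _ _ hV (hVX.trans (Submodule.map_le_iff_le_comap.2 hXY))
  exact (hCD T T' hT hT').false (eT.symm.trans (e.trans eT'))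

theorem exists_isCompl_factorIn [IsArtinian B M] [IsNoetherian B M]
    (hCD : ∀ U V : Submodule B M, U ⋖ V → FactorIn C U V ∨ FactorIn D U V)
    (hext : ∀ T T', C T → D T' → ¬ HasNonsplitExt B T T' ∧ ¬ HasNonsplitExt B T' T) :
    ∃ P Q : Submodule B M, IsCompl P Q ∧ (∀ U V, U ⋖ V → V ≤ P → FactorIn C U V) ∧
      (∀ U V, U ⋖ V → V ≤ Q → FactorIn D U V) := by
  refine exists_isCompl_of_split (fun X Y _ => factorIn_inf_iff_sup X Y)
    (fun X Y _ => factorIn_inf_iff_sup X Y) hCD ?_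
  rintro U V W hUV hVW (⟨⟨T, hT, ⟨e⟩⟩, ⟨T', hT', ⟨e'⟩⟩⟩ | ⟨⟨T, hT, ⟨e⟩⟩, ⟨T', hT', ⟨e'⟩⟩⟩)
  · exact exists_complement_of_not_hasNonsplitExt hUV.le hVW.le e e' (hext _ _ hT' hT).1
  · exact exists_complement_of_not_hasNonsplitExt hUV.le hVW.le e e' (hext _ _ hT hT').2

theorem map_mem_of_factorIn_isCompl [IsArtinian B M]
    (hCD : ∀ T T', C T → D T' → IsEmpty (T ≃ₗ[B] T')) {P Q : Submodule B M} (hPQ : IsCompl P Q)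
    (hP : ∀ U V, U ⋖ V → V ≤ P → FactorIn C U V)
    (hQ : ∀ U V, U ⋖ V → V ≤ Q → FactorIn D U V) (φ : M →ₗ[B] M) : ∀ x ∈ P, φ x ∈ P := by
  intro x hx
  have := map_eq_zero_of_factorIn hCD (Q.subtype ∘ₗ Submodule.projectionOnto Q P hPQ.symm ∘ₗ φ)
    (fun y _ => Subtype.coe_prop _) hP hQ x hx
  simpa using this

end Factor

section Graded

open MulOpposite DirectSum

variable {k A : Type} [Field k] [Ring A] [Algebra k A] (𝒜 : ℕ → Submodule k A)

/-- Every homogeneous element of positive degree acts as zero on the right `A`-module `T`. -/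
def IsConcentratedInDegreeZero (T : Type) [AddCommGroup T] [Module Aᵐᵒᵖ T] : Prop :=
  ∀ (x : T) (n : ℕ), 1 ≤ n → ∀ a ∈ 𝒜 n, op a • x = 0

variable [GradedAlgebra 𝒜]

theorem decompose_mul_eq_zero_of_left {n : ℕ} {x : A}
    (hx : ∀ i < n, (decompose 𝒜 x i : A) = 0) (y : A) :
    ∀ i < n, (decompose 𝒜 (x * y) i : A) = 0 := by
  intro i hi
  induction y using DirectSum.Decomposition.inductionOn 𝒜 with
  | zero => simp
  | @homogeneous j m =>
    by_cases h : j ≤ i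
    · rw [coe_decompose_mul_of_right_mem_of_le 𝒜 m.2 h, hx _ (by omega), zero_mul]
    · rw [coe_decompose_mul_of_right_mem_of_not_le 𝒜 m.2 h]
  | add a b ha hb => rw [mul_add, decompose_add, DirectSum.add_apply, Submodule.coe_add, ha, hb, add_zero]

theorem decompose_mul_eq_zero_of_right {n : ℕ} {x : A}
    (hx : ∀ i < n, (decompose 𝒜 x i : A) = 0) (y : A) :
    ∀ i < n, (decompose 𝒜 (y * x) i : A) = 0 := by
  intro i hi
  induction y using DirectSum.Decomposition.inductionOn 𝒜 with
  | zero => simp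
  | @homogeneous j m =>
    by_cases h : j ≤ i
    · rw [coe_decompose_mul_of_left_mem_of_le 𝒜 m.2 h, hx _ (by omega), mul_zero]
    · rw [coe_decompose_mul_of_left_mem_of_not_le 𝒜 m.2 h]
  | add a b ha hb => rw [add_mul, decompose_add, DirectSum.add_apply, Submodule.coe_add, ha, hb, add_zero]

/-- The right ideal of elements of `A` whose components of degree less than `n` vanish. -/
def degreeGEIdeal (n : ℕ) : Submodule Aᵐᵒᵖ Aᵐᵒᵖ where
  carrier := {b | ∀ i < n, (decompose 𝒜 (unop b) i : A) = 0}
  add_mem' ha hb i hi := by simp [ha i hi, hb i hi]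
  zero_mem' i _ := by simp
  smul_mem' c _ hx := decompose_mul_eq_zero_of_left 𝒜 hx (unop c)

variable {𝒜}

theorem mem_degreeGEIdeal {n : ℕ} {b : Aᵐᵒᵖ} :
    b ∈ degreeGEIdeal 𝒜 n ↔ ∀ i < n, (decompose 𝒜 (unop b) i : A) = 0 := Iff.rfl

theorem mul_mem_degreeGEIdeal {n : ℕ} {b : Aᵐᵒᵖ} (hb : b ∈ degreeGEIdeal 𝒜 n) (c : Aᵐᵒᵖ) :
    b * c ∈ degreeGEIdeal 𝒜 n :=
  decompose_mul_eq_zero_of_right 𝒜 hb (unop c)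

theorem op_mem_degreeGEIdeal {n i : ℕ} (h : n ≤ i) {a : A} (ha : a ∈ 𝒜 i) :
    op a ∈ degreeGEIdeal 𝒜 n := fun j hj =>
  decompose_of_mem_ne 𝒜 ha (by omega)

theorem finite_quotient_degreeGEIdeal (hfin : ∀ i, FiniteDimensional k (𝒜 i)) (n : ℕ) :
    Module.Finite k (Aᵐᵒᵖ ⧸ degreeGEIdeal 𝒜 n) := by
  let f : Aᵐᵒᵖ →ₗ[k] (i : Fin n) → 𝒜 i := LinearMap.pi fun i =>
    DirectSum.component k ℕ (fun i => 𝒜 i) i ∘ₗ (decomposeLinearEquiv 𝒜).toLinearMap ∘ₗ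
      (opLinearEquiv k).symm.toLinearMap
  have hf : (degreeGEIdeal 𝒜 n).restrictScalars k = LinearMap.ker f := by
    ext b
    rw [Submodule.restrictScalars_mem, mem_degreeGEIdeal, LinearMap.mem_ker, funext_iff]
    constructor
    · exact fun h i => Subtype.ext (h i i.2)
    · exact fun h i hi => congrArg Subtype.val (h ⟨i, hi⟩)
  have e := ((Submodule.Quotient.restrictScalarsEquiv k (degreeGEIdeal 𝒜 n)).symm.trans
    (Submodule.quotEquivOfEq _ _ hf)).trans f.quotKerEquivRange
  exact Module.Finite.equiv e.symm

namespace IsConcentratedInDegreeZero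

variable {T : Type} [AddCommGroup T] [Module Aᵐᵒᵖ T]

theorem op_smul (h : IsConcentratedInDegreeZero 𝒜 T) (a : A) (x : T) :
    op a • x = op (decompose 𝒜 a 0 : A) • x := by
  induction a using DirectSum.Decomposition.inductionOn 𝒜 with
  | zero => simp
  | @homogeneous j m =>
    rcases Nat.eq_zero_or_pos j with rfl | hj
    · rw [decompose_of_mem_same 𝒜 m.2]
    · rw [decompose_of_mem_ne 𝒜 m.2 hj.ne', h x j hj m m.2, op_zero, zero_smul]
  | add a b ha hb => simp [add_smul, ha, hb]

theorem of_isSimpleModule [IsSimpleModule Aᵐᵒᵖ T] (n : ℕ)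
    (h : ∀ (x : T) (i : ℕ), n ≤ i → ∀ a ∈ 𝒜 i, op a • x = 0) :
    IsConcentratedInDegreeZero 𝒜 T := by
  let N : Submodule Aᵐᵒᵖ T :=
    { carrier := {x | ∀ i, 1 ≤ i → ∀ a ∈ 𝒜 i, op a • x = 0}
      add_mem' := fun hx hy i hi a ha => by rw [smul_add, hx i hi a ha, hy i hi a ha, add_zero]
      zero_mem' := fun i _ a _ => smul_zero _
      smul_mem' := fun b x hx i hi a ha => by
        rw [← mul_smul, ← op_unop b, ← op_mul]
        induction unop b using DirectSum.Decomposition.inductionOn 𝒜 with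
        | zero => simp
        | @homogeneous j m => exact hx (j + i) (by omega) _ (SetLike.mul_mem_graded m.2 ha)
        | add b c hb hc => rw [add_mul, op_add, add_smul, hb, hc, add_zero] }
  rcases eq_bot_or_eq_top N with hN | hN
  · exfalso
    have key : ∀ x : T, x ≠ 0 → ∀ m, ∃ i, m ≤ i ∧ ∃ a ∈ 𝒜 i, op a • x ≠ 0 := by
      intro x hx m
      induction m with
      | zero => exact ⟨0, le_rfl, 1, SetLike.one_mem_graded 𝒜, by simpa using hx⟩
      | succ m ih =>
        obtain ⟨i, hi, a, ha, hax⟩ := ih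
        have hmem : op a • x ∉ N := by rwa [hN, Submodule.mem_bot]
        have : ∃ j, 1 ≤ j ∧ ∃ b ∈ 𝒜 j, op b • op a • x ≠ 0 := by
          by_contra! hcon
          exact hmem hcon
        obtain ⟨j, hj, b, hb, hbx⟩ := this
        refine ⟨i + j, by omega, a * b, SetLike.mul_mem_graded ha hb, ?_⟩
        rwa [op_mul, mul_smul]
    have := IsSimpleModule.nontrivial Aᵐᵒᵖ T
    obtain ⟨x, hx⟩ := exists_ne (0 : T)
    obtain ⟨i, hi, a, ha, hax⟩ := key x hx n
    exact hax (h x i hi a ha)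
  · intro x
    exact (hN ▸ Submodule.mem_top : x ∈ N)

/-- The module map `A / A_{≥ n} → T` sending `1` to `x`. -/
def ofQuotient (h : IsConcentratedInDegreeZero 𝒜 T) {n : ℕ} (hn : 1 ≤ n) (x : T) :
    (Aᵐᵒᵖ ⧸ degreeGEIdeal 𝒜 n) →ₗ[Aᵐᵒᵖ] T :=
  (degreeGEIdeal 𝒜 n).liftQ (LinearMap.toSpanSingleton Aᵐᵒᵖ T x) fun b hb => by
    rw [LinearMap.mem_ker, LinearMap.toSpanSingleton_apply, ← op_unop b, h.op_smul,
      hb 0 hn, op_zero, zero_smul]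

theorem ofQuotient_mk (h : IsConcentratedInDegreeZero 𝒜 T) {n : ℕ} (hn : 1 ≤ n) (x : T)
    (b : Aᵐᵒᵖ) : h.ofQuotient hn x (Submodule.Quotient.mk b) = b • x := rfl

end IsConcentratedInDegreeZero

theorem factor_isConcentratedInDegreeZero {n : ℕ}
    {U V : Submodule Aᵐᵒᵖ (Aᵐᵒᵖ ⧸ degreeGEIdeal 𝒜 n)}
    [IsSimpleModule Aᵐᵒᵖ (V ⧸ U.comap V.subtype)] :
    IsConcentratedInDegreeZero 𝒜 (V ⧸ U.comap V.subtype) := by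
  refine .of_isSimpleModule n fun x i hi a ha => ?_
  induction x using Submodule.Quotient.induction_on with
  | H v =>
  have hv : op a • v = 0 := by
    obtain ⟨v, hv⟩ := v
    refine Subtype.ext ?_
    induction v using Submodule.Quotient.induction_on with
    | H b =>
    exact (Submodule.Quotient.mk_eq_zero _).2
      (mul_mem_degreeGEIdeal (op_mem_degreeGEIdeal hi ha) b)
  rw [← Submodule.Quotient.mk_smul, hv, Submodule.Quotient.mk_zero]

theorem exists_idempotent_commute_lt (hfin : ∀ i, FiniteDimensional k (𝒜 i))
    {C D : ModuleCat.{0} Aᵐᵒᵖ → Prop}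
    (hiso : ∀ T T', C T → D T' → IsEmpty (T ≃ₗ[Aᵐᵒᵖ] T'))
    (hext : ∀ T T', C T → D T' → ¬ HasNonsplitExt Aᵐᵒᵖ T T' ∧ ¬ HasNonsplitExt Aᵐᵒᵖ T' T)
    (hall : ∀ T : ModuleCat.{0} Aᵐᵒᵖ, IsSimpleModule Aᵐᵒᵖ T →
      IsConcentratedInDegreeZero 𝒜 T → C T ∨ D T)
    {S S' : ModuleCat.{0} Aᵐᵒᵖ} [IsSimpleModule Aᵐᵒᵖ S] [IsSimpleModule Aᵐᵒᵖ S']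
    (hS : IsConcentratedInDegreeZero 𝒜 S) (hS' : IsConcentratedInDegreeZero 𝒜 S')
    (hCS : C S) (hDS' : D S') {n : ℕ} (hn : 1 ≤ n) :
    ∃ e ∈ 𝒜 0, IsIdempotentElem e ∧ (∀ i < n, ∀ b ∈ 𝒜 i, e * b = b * e) ∧
      (∀ s : S, op e • s = s) ∧ (∀ s : S', op e • s = 0) := by
  let I := degreeGEIdeal 𝒜 n
  have := finite_quotient_degreeGEIdeal hfin n
  have : IsArtinian Aᵐᵒᵖ (Aᵐᵒᵖ ⧸ I) := isArtinian_of_tower k inferInstance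
  have : IsNoetherian Aᵐᵒᵖ (Aᵐᵒᵖ ⧸ I) := isNoetherian_of_tower k inferInstance
  have hiso' : ∀ T T', D T → C T' → IsEmpty (T ≃ₗ[Aᵐᵒᵖ] T') :=
    fun T T' hT hT' => ⟨fun e => (hiso T' T hT' hT).false e.symm⟩
  have hfactor : ∀ U V : Submodule Aᵐᵒᵖ (Aᵐᵒᵖ ⧸ I), U ⋖ V →
      FactorIn C U V ∨ FactorIn D U V := by
    intro U V hUV
    have := (covBy_iff_quot_is_simple hUV.le).1 hUV
    exact (hall (ModuleCat.of Aᵐᵒᵖ (V ⧸ U.comap V.subtype)) this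
      factor_isConcentratedInDegreeZero).imp
      (fun h => ⟨_, h, ⟨LinearEquiv.refl _ _⟩⟩) (fun h => ⟨_, h, ⟨LinearEquiv.refl _ _⟩⟩)
  obtain ⟨P, Q, hPQ, hP, hQ⟩ := exists_isCompl_factorIn hfactor hext
  let mk : Aᵐᵒᵖ → Aᵐᵒᵖ ⧸ I := Submodule.Quotient.mk
  obtain ⟨x, hx, y, hy, hxy⟩ := Submodule.mem_sup.1
    (hPQ.sup_eq_top ▸ Submodule.mem_top : mk 1 ∈ P ⊔ Q)
  obtain ⟨e, rfl⟩ := Submodule.Quotient.mk_surjective I x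
  obtain rfl : y = mk (1 - e) := by
    rw [← eq_sub_iff_add_eq'] at hxy
    exact hxy
  have hright : ∀ b c : Aᵐᵒᵖ, mk c ∈ P → mk (c * b) ∈ P := fun b c hc =>
    map_mem_of_factorIn_isCompl hiso hPQ hP hQ (I.mapQ I (LinearMap.toSpanSingleton Aᵐᵒᵖ Aᵐᵒᵖ b)
      fun a ha => mul_mem_degreeGEIdeal ha b) _ hc
  have hright' : ∀ b c : Aᵐᵒᵖ, mk c ∈ Q → mk (c * b) ∈ Q := fun b c hc =>
    map_mem_of_factorIn_isCompl hiso' hPQ.symm hQ hP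
      (I.mapQ I (LinearMap.toSpanSingleton Aᵐᵒᵖ Aᵐᵒᵖ b)
      fun a ha => mul_mem_degreeGEIdeal ha b) _ hc
  have hdisj : ∀ b : Aᵐᵒᵖ, mk b ∈ P → mk b ∈ Q → b ∈ I := fun b h h' =>
    (Submodule.Quotient.mk_eq_zero I).1 (Submodule.disjoint_def.1 hPQ.disjoint _ h h')
  have hcomm : ∀ b, b * e - e * b ∈ I := by
    intro b
    refine hdisj _ (P.sub_mem (P.smul_mem b hx) (hright b e hx)) ?_
    have := Q.sub_mem (hright' b _ hy) (Q.smul_mem b hy)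
    convert this using 1
    change mk _ = mk ((1 - e) * b - b * (1 - e))
    congr 1
    noncomm_ring
  have hidem : e * e - e ∈ I := by
    have h1 : mk ((1 - e) * e) ∈ P := P.smul_mem (1 - e) hx
    have h2 : mk ((1 - e) * e) ∈ Q := hright' e _ hy
    have := I.neg_mem (hdisj _ h1 h2)
    convert this using 1
    noncomm_ring
  have hactS : ∀ s : S, e • s = s := by
    intro s
    have := map_eq_zero_of_factorIn hiso' (hS.ofQuotient hn s) (Y := ⊤)
      (fun _ _ => Submodule.mem_top) hQ (fun U V h _ => factorIn_of_isSimpleModule hCS U V h) _ hy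
    rw [hS.ofQuotient_mk, sub_smul, one_smul, sub_eq_zero] at this
    exact this.symm
  have hactS' : ∀ s : S', e • s = 0 := fun s =>
    map_eq_zero_of_factorIn hiso (hS'.ofQuotient hn s) (Y := ⊤)
      (fun _ _ => Submodule.mem_top) hP (fun U V h _ => factorIn_of_isSimpleModule hDS' U V h) _ hx
  refine ⟨decompose 𝒜 (unop e) 0, SetLike.coe_mem _, ?_, ?_, ?_, ?_⟩
  · have h0 := hidem 0 hn
    have h1 := map_mul (GradedRing.projZeroRingHom 𝒜) (unop e) (unop e)
    simp only [GradedRing.projZeroRingHom_apply] at h1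
    rw [unop_sub, unop_mul, decompose_sub, DirectSum.sub_apply, AddSubgroupClass.coe_sub,
      sub_eq_zero, h1] at h0
    exact h0
  · intro i hi b hb
    have h0 := hcomm (op b) i hi
    have h1 := coe_decompose_mul_add_of_right_mem 𝒜 (i := 0) (a := unop e) hb
    have h2 := coe_decompose_mul_add_of_left_mem 𝒜 (j := 0) (b := unop e) hb
    rw [zero_add] at h1
    rw [add_zero] at h2
    rw [unop_sub, unop_mul, unop_mul, unop_op, decompose_sub, DirectSum.sub_apply,
      AddSubgroupClass.coe_sub, sub_eq_zero, h1, h2] at h0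
    exact h0
  · intro s
    rw [← hS.op_smul, op_unop, hactS]
  · intro s
    rw [← hS'.op_smul, op_unop, hactS']

theorem exists_commute_lt_imp_commute [FiniteDimensional k (𝒜 0)] :
    ∃ n, ∀ e ∈ 𝒜 0, (∀ i < n, ∀ b ∈ 𝒜 i, e * b = b * e) → ∀ b, e * b = b * e := by
  let V : ℕ →o (Submodule k (𝒜 0))ᵒᵈ :=
    { toFun := fun n => OrderDual.toDual
        { carrier := {e | ∀ i < n, ∀ b ∈ 𝒜 i, (e : A) * b = b * e}
          add_mem' := fun hx hy i hi b hb => by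
            simp [add_mul, mul_add, hx i hi b hb, hy i hi b hb]
          zero_mem' := fun i _ b _ => by simp
          smul_mem' := fun c x hx i hi b hb => by simp [hx i hi b hb] }
      monotone' := fun m n hmn x hx i hi => hx i (hi.trans_le hmn) }
  obtain ⟨n, hn⟩ := IsArtinian.monotone_stabilizes V
  refine ⟨n, fun e he h b => ?_⟩
  induction b using DirectSum.Decomposition.inductionOn 𝒜 with
  | zero => simp
  | @homogeneous j m =>
    have h1 : (⟨e, he⟩ : 𝒜 0) ∈ (OrderDual.ofDual (V (max n (j + 1))) : Submodule k (𝒜 0)) := by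
      rw [← hn _ (le_max_left _ _)]
      exact h
    exact h1 j (by omega) m m.2
  | add a b ha hb => rw [mul_add, add_mul, ha, hb]

end Graded

theorem exists_ringEquiv_prod_of_isIdempotentElem {A : Type} [Ring A] {e : A}
    (he : IsIdempotentElem e) (hc : ∀ b, e * b = b * e) (h0 : e ≠ 0) (h1 : e ≠ 1) :
    ∃ (R S : Type) (_ : Ring R) (_ : Ring S) (_ : Nontrivial R) (_ : Nontrivial S),
      Nonempty (A ≃+* R × S) := by
  have hco : CompleteOrthogonalIdempotents ![e, 1 - e] :=
    CompleteOrthogonalIdempotents.pair_iff.2 ⟨he, rfl⟩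
  have hcentral : ∀ i, IsMulCentral (![e, 1 - e] i) := by
    intro i
    refine Semigroup.mem_center_iff.2 fun b => ?_
    fin_cases i
    · exact (hc b).symm
    · simp [mul_sub, sub_mul, hc b]
  have hnt : ∀ i, ![e, 1 - e] i ≠ 0 := by
    intro i
    fin_cases i
    · exact h0
    · exact sub_ne_zero.2 h1.symm
  have hnt' : ∀ i, Nontrivial (hco.idem i).Corner := fun i =>
    ⟨⟨1, 0, fun h => hnt i (congrArg Subtype.val h)⟩⟩
  exact ⟨_, _, inferInstance, inferInstance, hnt' 0, hnt' 1,
    ⟨(hco.ringEquivOfIsMulCentral hcentral).trans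
      (RingEquiv.piFinTwo fun i => (hco.idem i).Corner)⟩⟩

theorem Relation.ReflTransGen.exists_relSeries {α : Type*} {r : SetRel α α} {a b : α}
    (h : Relation.ReflTransGen (fun x y => (x, y) ∈ r) a b) :
    ∃ p : RelSeries r, p.head = a ∧ p.last = b := by
  induction h with
  | refl => exact ⟨RelSeries.singleton r a, rfl, rfl⟩
  | @tail c d _ hcd ih =>
    obtain ⟨p, hp, rfl⟩ := ih
    exact ⟨p.snoc d hcd, by rw [RelSeries.head_snoc, hp], RelSeries.last_snoc _ _ _⟩

/-- **Lemma (`connected`).**  Let `A` be a ring-indecomposable locally finite `ℕ`-graded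
algebra over a field `k`.  Then for any two non-isomorphic simple right `A`-modules `S, S'`
concentrated in degree `0`, there is a finite sequence `S = S⁰, S¹, …, S^ℓ = S'` of simple
right `A`-modules concentrated in degree `0` such that for each `0 ≤ i ≤ ℓ−1` either
`Ext¹_A(Sⁱ, S^{i+1}) ≠ 0` or `Ext¹_A(S^{i+1}, Sⁱ) ≠ 0`. -/
theorem stmt_14 (k : Type) [Field k] (A : Type) [Ring A] [Algebra k A]
    (𝒜 : ℕ → Submodule k A) [GradedAlgebra 𝒜]
    (hlocfin : ∀ i : ℕ, FiniteDimensional k (𝒜 i))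
    (hindec : ¬ ∃ (R S : Type) (_ : Ring R) (_ : Ring S) (_ : Nontrivial R)
      (_ : Nontrivial S), Nonempty (A ≃+* R × S))
    (S S' : ModuleCat.{0} Aᵐᵒᵖ)
    (hS : IsSimpleModule Aᵐᵒᵖ S) (hS' : IsSimpleModule Aᵐᵒᵖ S')
    (hSdeg : ∀ (x : S) (i : ℕ), 1 ≤ i → ∀ a ∈ 𝒜 i, MulOpposite.op a • x = 0)
    (hS'deg : ∀ (x : S') (i : ℕ), 1 ≤ i → ∀ a ∈ 𝒜 i, MulOpposite.op a • x = 0)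
    (hne : IsEmpty (S ≃ₗ[Aᵐᵒᵖ] S')) :
    ∃ (ℓ : ℕ) (T : Fin (ℓ + 1) → ModuleCat.{0} Aᵐᵒᵖ),
      T 0 = S ∧ T (Fin.last ℓ) = S' ∧
      (∀ i, IsSimpleModule Aᵐᵒᵖ (T i)) ∧
      (∀ (i : Fin (ℓ + 1)) (x : T i) (n : ℕ), 1 ≤ n → ∀ a ∈ 𝒜 n,
        MulOpposite.op a • x = 0) ∧
      (∀ i : Fin ℓ,
        HasNonsplitExt Aᵐᵒᵖ (T i.castSucc) (T i.succ) ∨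
        HasNonsplitExt Aᵐᵒᵖ (T i.succ) (T i.castSucc)) := by
  let α := {T : ModuleCat.{0} Aᵐᵒᵖ // IsSimpleModule Aᵐᵒᵖ T ∧ IsConcentratedInDegreeZero 𝒜 T}
  let r : SetRel α α :=
    {p | HasNonsplitExt Aᵐᵒᵖ p.1.1 p.2.1 ∨ HasNonsplitExt Aᵐᵒᵖ p.2.1 p.1.1}
  let s : α := ⟨S, hS, hSdeg⟩
  by_contra hno
  let conn : α → Prop := fun T =>
    Nonempty (S ≃ₗ[Aᵐᵒᵖ] T.1) ∨ Relation.TransGen (fun x y => (x, y) ∈ r) s T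
  have hconn_iso : ∀ T T' : α, conn T → (T.1 ≃ₗ[Aᵐᵒᵖ] T'.1) → conn T' := by
    rintro T T' (⟨⟨e⟩⟩ | h) e'
    · exact .inl ⟨e.trans e'⟩
    · obtain ⟨U, hU, hUT⟩ := Relation.TransGen.tail'_iff.1 h
      exact .inr (.tail' hU (hUT.imp (·.congr_right e') (·.congr_left e')))
  have hconn_ext : ∀ T T' : α, conn T → (T, T') ∈ r → conn T' := by
    rintro T T' (⟨⟨e⟩⟩ | h) hr
    · exact .inr (.single (hr.imp (·.congr_left e.symm) (·.congr_right e.symm)))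
    · exact .inr (h.tail hr)
  let C : ModuleCat.{0} Aᵐᵒᵖ → Prop := fun T => ∃ h, conn ⟨T, h⟩
  let D : ModuleCat.{0} Aᵐᵒᵖ → Prop := fun T => ∃ h, ¬ conn ⟨T, h⟩
  have hCS : C S := ⟨⟨hS, hSdeg⟩, .inl ⟨LinearEquiv.refl _ _⟩⟩
  have hDS' : D S' := by
    refine ⟨⟨hS', hS'deg⟩, ?_⟩
    rintro (⟨⟨e⟩⟩ | h)
    · exact hne.false e
    · obtain ⟨p, hp, hp'⟩ := h.to_reflTransGen.exists_relSeries
      exact hno ⟨p.length, fun i => (p i).1, congrArg Subtype.val hp, congrArg Subtype.val hp',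
        fun i => (p i).2.1, fun i => (p i).2.2, fun i => p.step i⟩
  obtain ⟨n, hn⟩ := exists_commute_lt_imp_commute (𝒜 := 𝒜)
  obtain ⟨e, he, hidem, hcomm, hS1, hS'0⟩ := exists_idempotent_commute_lt hlocfin (C := C) (D := D)
    (fun T T' ⟨_, h⟩ ⟨_, h'⟩ => ⟨fun e => h' (hconn_iso _ _ h e)⟩)
    (fun T T' ⟨_, h⟩ ⟨_, h'⟩ => ⟨fun hr => h' (hconn_ext _ _ h (.inl hr)),
      fun hr => h' (hconn_ext _ _ h (.inr hr))⟩)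
    (fun T h h' => (em (conn ⟨T, h, h'⟩)).imp (fun hc => ⟨⟨h, h'⟩, hc⟩) (fun hc => ⟨⟨h, h'⟩, hc⟩))
    hSdeg hS'deg hCS hDS' (Nat.le_add_left 1 n)
  have := IsSimpleModule.nontrivial Aᵐᵒᵖ S
  have := IsSimpleModule.nontrivial Aᵐᵒᵖ S'
  obtain ⟨x, hx⟩ := exists_ne (0 : S)
  obtain ⟨x', hx'⟩ := exists_ne (0 : S')
  refine hindec (exists_ringEquiv_prod_of_isIdempotentElem hidem
    (hn e he fun i hi => hcomm i (by omega)) ?_ ?_)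
  · rintro rfl
    exact hx (by simpa using (hS1 x).symm)
  · rintro rfl
    exact hx' (by simpa using hS'0 x')
end

section
/- Let A be a locally finite ℕ-graded k-algebra over a field k that is basic, i.e. A₀/rad(A₀) is a finite product of division k-algebras. Let J := rad(A₀) ⊕ A_{≥1}, a two-sided ideal of A, and set Ā := A/J, a right A-module. If e, f ∈ A₀ are idempotents with e + f = 1 and Ext¹_A(eĀ, fĀ) = 0 = Ext¹_A(fĀ, eĀ), then eAf = 0 = fAe; consequently A ≅ eAe × fAf as rings. -/
noncomputable section

/-- A finite-dimensional algebra `A₀` is basic if `A₀ / rad A₀` is isomorphic to a finite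
product of division `k`-algebras; equivalently, there is a surjective `k`-algebra map from
`A₀` onto a finite product of division `k`-algebras whose kernel is the Jacobson radical. -/
def IsBasic (k A₀ : Type) [Field k] [Ring A₀] [Algebra k A₀] : Prop :=
  ∃ (n : ℕ) (D : Fin n → Type) (hD : ∀ i, DivisionRing (D i)),
    letI : ∀ i, DivisionRing (D i) := hD
    ∃ hDA : ∀ i, Algebra k (D i),
      letI : ∀ i, Algebra k (D i) := hDA
      ∃ φ : A₀ →ₐ[k] (∀ i, D i), Function.Surjective φ ∧
        RingHom.ker (φ : A₀ →+* ∀ i, D i) = Ideal.jacobson (⊥ : Ideal A₀)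

variable (A : Type) [Ring A]

/-- Left multiplication by `e`, as an endomorphism of `A` viewed as a right `A`-module. -/
def lmulLin (e : A) : A →ₗ[Aᵐᵒᵖ] A where
  toFun x := e * x
  map_add' x y := mul_add e x y
  map_smul' c x := by
    simp only [MulOpposite.smul_eq_mul_unop, RingHom.id_apply, mul_assoc]

variable (k : Type) [Field k] [Algebra k A] (𝒜 : ℕ → Submodule k A) [GradedAlgebra 𝒜]

/-- The two-sided ideal `J = rad(A₀) ⊕ A_{≥1}`, viewed as a right ideal of `A`
(it is the right `A`-submodule generated by `rad(A₀)` and the elements of positive degree). -/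
def radJ : Submodule Aᵐᵒᵖ A :=
  Submodule.span Aᵐᵒᵖ
    (((fun x : ↥(𝒜 0) => (x : A)) ''
        {x : ↥(𝒜 0) | x ∈ Ideal.jacobson (⊥ : Ideal ↥(𝒜 0))}) ∪
      {a : A | ∃ i : ℕ, 1 ≤ i ∧ a ∈ 𝒜 i})

/-- The right `A`-module `e·Ā`, where `Ā = A/J`. -/
def cornerBar (e : A) : Submodule Aᵐᵒᵖ (A ⧸ radJ A k 𝒜) :=
  Submodule.map (radJ A k 𝒜).mkQ (LinearMap.range (lmulLin A e))

/-- The corner set `eAe = {x | e x = x = x e}` of `A`, as a non-unital subring. -/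
def cornerNUS (e : A) : NonUnitalSubring A where
  carrier := {x : A | e * x = x ∧ x * e = x}
  zero_mem' := by simp
  add_mem' := by
    rintro x y ⟨hx1, hx2⟩ ⟨hy1, hy2⟩
    exact ⟨by rw [mul_add, hx1, hy1], by rw [add_mul, hx2, hy2]⟩
  neg_mem' := by
    rintro x ⟨hx1, hx2⟩
    exact ⟨by rw [mul_neg, hx1], by rw [neg_mul, hx2]⟩
  mul_mem' := by
    rintro x y ⟨hx1, hx2⟩ ⟨hy1, hy2⟩
    exact ⟨by rw [← mul_assoc, hx1], by rw [mul_assoc, hy2]⟩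

/-- For an idempotent `e`, the corner `eAe` is a (unital) ring with unit `e`. -/
def cornerRing {e : A} (he : e * e = e) : Ring ↥(cornerNUS A e) :=
  { (inferInstance : NonUnitalRing ↥(cornerNUS A e)) with
    one := ⟨e, he, he⟩
    one_mul := fun x => Subtype.ext (show e * (x : A) = (x : A) from x.2.1)
    mul_one := fun x => Subtype.ext (show (x : A) * e = (x : A) from x.2.2) }

theorem exists_linearMap_self_apply_ne_zero {S M : Type*} [Ring S] [IsSemisimpleRing S]
    [AddCommGroup M] [Module S M] {m : M} (hm : m ≠ 0) : ∃ l : M →ₗ[S] S, l m ≠ 0 := by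
  obtain ⟨s, hs⟩ := (Module.projective_of_isSemisimpleRing S M).out
  by_contra! h
  refine hm ?_
  have h0 : s m = 0 := by
    ext i
    exact h (Finsupp.lapply i ∘ₗ s)
  rw [← hs m, h0, map_zero]

theorem exists_linearMap_quotient_apply_ne_zero {R M : Type*} [Ring R] (I : Ideal R)
    [I.IsTwoSided] [IsSemisimpleRing (R ⧸ I)] [AddCommGroup M] [Module R M]
    (hM : Module.IsTorsionBySet R M I) {m : M} (hm : m ≠ 0) :
    ∃ l : M →ₗ[R] R ⧸ I, l m ≠ 0 := by
  letI := hM.module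
  obtain ⟨l, hl⟩ := exists_linearMap_self_apply_ne_zero (S := R ⧸ I) hm
  exact ⟨{ toFun := l
           map_add' := map_add l
           map_smul' := fun r x => map_smul l (Ideal.Quotient.mk I r) x }, hl⟩

/-- If `Ext¹(M, N)` vanishes, then every map to `N` from the kernel of a surjection `P → M`
extends to `P`. -/
theorem exists_extension_of_not_hasNonsplitExt {R M N P : Type} [Ring R]
    [AddCommGroup M] [Module R M] [AddCommGroup N] [Module R N] [AddCommGroup P] [Module R P]
    (h : ¬ HasNonsplitExt R M N) (g : P →ₗ[R] M) (hg : Function.Surjective g)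
    (φ : LinearMap.ker g →ₗ[R] N) : ∃ ψ : P →ₗ[R] N, ∀ x : LinearMap.ker g, ψ x = φ x := by
  let S : Submodule R (P × N) := LinearMap.range ((LinearMap.ker g).subtype.prod (-φ))
  have hS : S ≤ LinearMap.ker (g ∘ₗ LinearMap.fst R P N) := by
    rintro _ ⟨x, rfl⟩
    exact x.2
  let i : N →ₗ[R] (P × N) ⧸ S := S.mkQ ∘ₗ LinearMap.inr R P N
  let q : ((P × N) ⧸ S) →ₗ[R] M := S.liftQ (g ∘ₗ LinearMap.fst R P N) hS
  have hi : Function.Injective i := by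
    rw [← LinearMap.ker_eq_bot, LinearMap.ker_eq_bot']
    intro n hn
    obtain ⟨x, hx⟩ := (Submodule.Quotient.mk_eq_zero S).1 hn
    have h1 : (x : P) = 0 := congrArg Prod.fst hx
    have h2 : -φ x = n := congrArg Prod.snd hx
    rw [← h2, show x = 0 from Subtype.ext h1, map_zero, neg_zero]
  have hφ : ∀ x : LinearMap.ker g, S.mkQ ((x : P), 0) = i (φ x) := by
    intro x
    refine (Submodule.Quotient.eq S).2 ⟨x, ?_⟩
    simp
  have hqi : LinearMap.range i = LinearMap.ker q := by
    apply le_antisymm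
    · rintro _ ⟨n, rfl⟩
      simp [i, q]
    · intro y hy
      obtain ⟨⟨p, n⟩, rfl⟩ := S.mkQ_surjective y
      have hp : g p = 0 := hy
      refine ⟨φ ⟨p, hp⟩ + n, ?_⟩
      rw [map_add, ← hφ ⟨p, hp⟩]
      simp only [i, LinearMap.comp_apply, ← map_add, LinearMap.inr_apply, Prod.mk_add_mk,
        add_zero, zero_add]
  have hsplit : ∃ s : M →ₗ[R] (P × N) ⧸ S, q ∘ₗ s = LinearMap.id := by
    by_contra hns
    refine h ⟨ModuleCat.of R ((P × N) ⧸ S), i, q, hi, fun m => ?_, hqi, hns⟩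
    obtain ⟨p, rfl⟩ := hg m
    exact ⟨S.mkQ (p, 0), rfl⟩
  obtain ⟨s, hs⟩ := hsplit
  let d : P →ₗ[R] (P × N) ⧸ S := S.mkQ ∘ₗ LinearMap.inl R P N - s ∘ₗ g
  have hd : ∀ p, d p ∈ LinearMap.range i := by
    intro p
    rw [hqi, LinearMap.mem_ker]
    have := LinearMap.congr_fun hs (g p)
    simp only [LinearMap.comp_apply, LinearMap.id_apply] at this
    simp [d, this, q]
  refine ⟨(LinearEquiv.ofInjective i hi).symm ∘ₗ d.codRestrict _ hd, fun x => ?_⟩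
  rw [LinearMap.comp_apply, LinearEquiv.coe_coe, LinearEquiv.symm_apply_eq]
  ext
  have hx : g x = 0 := x.2
  simp [d, hx, ← hφ]

theorem eq_bot_of_le_mul_add_mul {k A : Type*} [CommSemiring k] [Semiring A] [Algebra k A]
    {r Y : Submodule k A} (hr : IsNilpotent r) (hY : Y ≤ r * Y + Y * r) : Y = ⊥ := by
  let L : Module.End ℕ (Submodule k A) := LinearMap.mulLeft ℕ r
  let R : Module.End ℕ (Submodule k A) := LinearMap.mulRight ℕ r
  have hc : Commute L R := LinearMap.commute_mulLeft_right r r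
  have hL : IsNilpotent L := (LinearMap.isNilpotent_mulLeft_iff ℕ r).2 hr
  have hR : IsNilpotent R := (LinearMap.isNilpotent_mulRight_iff ℕ r).2 hr
  obtain ⟨n, hn⟩ := hc.isNilpotent_add hL hR
  have hmono : Monotone (L + R) := fun X Z h =>
    add_le_add (mul_le_mul_right h r) (mul_le_mul_left h r)
  have key : ∀ n : ℕ, Y ≤ ((L + R) ^ n) Y := by
    intro n
    induction n with
    | zero => exact le_rfl
    | succ n ih =>
      rw [pow_succ']
      exact hY.trans (hmono ih)
  have := key n
  rw [hn] at this
  exact le_bot_iff.1 this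

theorem map_mul_mul_eq_zero {A ι : Type*} [Ring A] {D : ι → Type*} [∀ i, DivisionRing (D i)]
    (Φ : A →+* ∀ i, D i) {e f : A} (he : e * e = e) (hef : e + f = 1) (a : A) :
    Φ (e * a * f) = 0 := by
  ext i
  have h1 : Φ e i * Φ e i = Φ e i := by rw [← Pi.mul_apply, ← map_mul, he]
  have h2 : Φ e i + Φ f i = 1 := by rw [← Pi.add_apply, ← map_add, hef, map_one, Pi.one_apply]
  simp only [map_mul, Pi.mul_apply, Pi.zero_apply]
  rcases IsIdempotentElem.iff_eq_zero_or_one.1 h1 with h | h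
  · simp [h]
  · have : Φ f i = 0 := by simpa [h] using h2
    simp [this]

theorem mul_mul_mem_ker_mul_ker {A : Type} [Ring A] {k : Type} [Field k] [Algebra k A]
    {𝒜 : ℕ → Submodule k A} [GradedAlgebra 𝒜] {ι : Type} [Finite ι] {D : ι → Type}
    [∀ i, DivisionRing (D i)] {Φ : A →+* ∀ i, D i} (hΦ : Function.Surjective Φ)
    (hJ : ∀ a, a ∈ radJ A k 𝒜 ↔ Φ a = 0) {e f : A} (he : e * e = e) (hf : f * f = f)
    (hef : e + f = 1)
    (hext : ¬ HasNonsplitExt Aᵐᵒᵖ ↥(cornerBar A k 𝒜 e) ↥(cornerBar A k 𝒜 f)) (a : A) :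
    e * a * f ∈ RingHom.ker Φ * RingHom.ker Φ := by
  set x := e * a * f with hx
  by_contra hxJ
  have hex : e * x = x := by rw [hx, mul_assoc e a f, ← mul_assoc, he]
  have hxf : x * f = x := by rw [hx, mul_assoc, hf]
  let Ψ : Aᵐᵒᵖ →+* ∀ i, (D i)ᵐᵒᵖ :=
    RingHom.pi fun i => RingHom.op ((Pi.evalRingHom D i).comp Φ)
  have hΨ : Function.Surjective Ψ := by
    intro y
    obtain ⟨b, hb⟩ := hΦ fun i => (y i).unop
    refine ⟨MulOpposite.op b, funext fun i => ?_⟩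
    exact congrArg MulOpposite.op (congrFun hb i)
  let I : Ideal Aᵐᵒᵖ := RingHom.ker Ψ
  have hI : ∀ c : Aᵐᵒᵖ, c ∈ I ↔ Φ c.unop = 0 := by
    intro c
    refine ⟨fun h => funext fun i => ?_, fun h => funext fun i => ?_⟩
    · exact congrArg MulOpposite.unop (congrFun h i)
    · exact congrArg MulOpposite.op (congrFun h i)
  have : IsSemisimpleRing (Aᵐᵒᵖ ⧸ I) :=
    (RingHom.quotientKerEquivOfSurjective hΨ).symm.isSemisimpleRing
  let J2 : Submodule Aᵐᵒᵖ A :=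
    { carrier := {b | e * b ∈ RingHom.ker Φ * RingHom.ker Φ}
      zero_mem' := by simp
      add_mem' := fun {b c} hb hc => by
        simp only [Set.mem_ofPred_eq, mul_add] at *
        exact add_mem hb hc
      smul_mem' := fun c b hb => by
        simp only [Set.mem_ofPred_eq, MulOpposite.smul_eq_mul_unop, ← mul_assoc] at *
        exact Ideal.mul_mem_right _ _ hb }
  let g : A →ₗ[Aᵐᵒᵖ] cornerBar A k 𝒜 e :=
    ((radJ A k 𝒜).mkQ ∘ₗ lmulLin A e).codRestrict _ fun b =>
      Submodule.mem_map_of_mem ⟨b, rfl⟩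
  have hg : Function.Surjective g := by
    rintro ⟨_, _, ⟨b, rfl⟩, rfl⟩
    exact ⟨b, rfl⟩
  have hgk : ∀ b, g b = 0 ↔ Φ (e * b) = 0 := by
    intro b
    rw [← hJ, ← Submodule.Quotient.mk_eq_zero]
    exact Subtype.ext_iff
  let K := J2.comap (LinearMap.ker g).subtype
  have hM : Module.IsTorsionBySet Aᵐᵒᵖ (↥(LinearMap.ker g) ⧸ K) I := by
    intro y c
    obtain ⟨y, rfl⟩ := K.mkQ_surjective y
    refine (Submodule.Quotient.mk_eq_zero K).2 ?_
    change e * (y.1 * c.1.unop) ∈ RingHom.ker Φ * RingHom.ker Φ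
    rw [← mul_assoc]
    exact Ideal.mul_mem_mul ((hgk _).1 y.2) ((hI _).1 c.2)
  have hxg : x ∈ LinearMap.ker g := by
    rw [LinearMap.mem_ker, hgk, hex]
    exact map_mul_mul_eq_zero Φ he hef a
  let m : ↥(LinearMap.ker g) ⧸ K := K.mkQ ⟨x, hxg⟩
  have hm : m ≠ 0 := by
    intro h
    have h' : e * x ∈ RingHom.ker Φ * RingHom.ker Φ := (Submodule.Quotient.mk_eq_zero K).1 h
    rw [hex] at h'
    exact hxJ h'
  have hmf : MulOpposite.op f • m = m :=
    congrArg K.mkQ (Subtype.ext hxf : MulOpposite.op f • (⟨x, hxg⟩ : LinearMap.ker g) = ⟨x, hxg⟩)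
  obtain ⟨l, hl⟩ := exists_linearMap_quotient_apply_ne_zero I hM hm
  let j : (Aᵐᵒᵖ ⧸ I) →ₗ[Aᵐᵒᵖ] A ⧸ radJ A k 𝒜 :=
    Submodule.mapQ I (radJ A k 𝒜) (LinearMap.toSpanSingleton Aᵐᵒᵖ A 1) fun c hc => by
      rw [Submodule.mem_comap, hJ]
      simpa using (hI c).1 hc
  have hj : ∀ y, j y = 0 → y = 0 := by
    intro y hy
    obtain ⟨c, rfl⟩ := Submodule.mkQ_surjective I y
    have h := (hJ _).1 ((Submodule.Quotient.mk_eq_zero _).1 hy)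
    refine (Submodule.Quotient.mk_eq_zero I).2 ((hI c).2 ?_)
    simpa using h
  let F : (A ⧸ radJ A k 𝒜) →ₗ[Aᵐᵒᵖ] cornerBar A k 𝒜 f :=
    (Submodule.mapQ (radJ A k 𝒜) (radJ A k 𝒜) (lmulLin A f) fun b hb => by
      rw [Submodule.mem_comap, hJ]
      change Φ (f * b) = 0
      rw [map_mul, (hJ b).1 hb, mul_zero]).codRestrict _ fun y => by
        obtain ⟨b, rfl⟩ := Submodule.mkQ_surjective _ y
        exact Submodule.mem_map_of_mem ⟨b, rfl⟩
  obtain ⟨ψ, hψ⟩ := exists_extension_of_not_hasNonsplitExt hext g hg (F ∘ₗ j ∘ₗ l ∘ₗ K.mkQ)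
  have hψx : ψ x = 0 := by
    have h1 : ψ x = MulOpposite.op x • ψ 1 := by
      rw [← map_smul, MulOpposite.smul_eq_mul_unop, one_mul, MulOpposite.unop_op]
    obtain ⟨_, ⟨b, rfl⟩, hb⟩ := (ψ 1).2
    rw [h1]
    ext
    rw [Submodule.coe_smul, ← hb]
    refine (Submodule.Quotient.mk_eq_zero (radJ A k 𝒜)).2 ((hJ _).2 ?_)
    change Φ (f * b * x) = 0
    rw [← hex, ← mul_assoc, map_mul, map_mul_mul_eq_zero Φ hf (by rw [add_comm, hef]), zero_mul]
  have hF : F (j (l m)) = 0 := (hψ ⟨x, hxg⟩).symm.trans hψx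
  refine hl (hj _ ?_)
  have hy : MulOpposite.op f • j (l m) = j (l m) := by rw [← map_smul, ← map_smul, hmf]
  obtain ⟨b, hb⟩ := Submodule.mkQ_surjective _ (j (l m))
  rw [← hy, map_smul, ← hb] at hF
  have h1 : Φ (f * b * f) = 0 :=
    (hJ _).1 ((Submodule.Quotient.mk_eq_zero (radJ A k 𝒜)).1 (congrArg Subtype.val hF))
  rw [← hy, ← hb]
  refine (Submodule.Quotient.mk_eq_zero (radJ A k 𝒜)).2 ((hJ _).2 ?_)
  change Φ (b * f) = 0
  rw [← one_mul b, ← hef, add_mul, add_mul, map_add, h1, map_mul_mul_eq_zero Φ he hef, add_zero]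

open DirectSum in
theorem mul_mul_eq_zero_of_mem_ker_mul_ker {A : Type*} [Ring A] {k : Type*} [Field k]
    [Algebra k A] {𝒜 : ℕ → Submodule k A} [GradedAlgebra 𝒜] {R : Type*} [Ring R] {Φ : A →+* R}
    (hΦ : ∀ a, Φ (decompose 𝒜 a 0 : A) = Φ a) {r : Submodule k A} (hr : IsNilpotent r)
    (hrΦ : ∀ b, b ∈ r ↔ b ∈ 𝒜 0 ∧ Φ b = 0) {e f : A} (he0 : e ∈ 𝒜 0) (hf0 : f ∈ 𝒜 0)
    (he : e * e = e) (hf : f * f = f) (hef : e + f = 1)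
    (h : ∀ a, e * a * f ∈ RingHom.ker Φ * RingHom.ker Φ) (a : A) : e * a * f = 0 := by
  have hmul0 : ∀ {x y : A}, x ∈ 𝒜 0 → y ∈ 𝒜 0 → x * y ∈ 𝒜 0 := fun hx hy => by
    simpa using SetLike.mul_mem_graded hx hy
  have hcomp : ∀ {x y : A}, x ∈ 𝒜 0 → Φ y = 0 →
      x * (decompose 𝒜 y 0 : A) * x ∈ r := fun {x y} hx hy =>
    (hrΦ _).2 ⟨hmul0 (hmul0 hx (SetLike.coe_mem _)) hx, by simp [hΦ, hy]⟩
  suffices hd : ∀ d : ℕ, ∀ b ∈ 𝒜 d, e * b * f = 0 by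
    classical
    rw [← sum_support_decompose 𝒜 a, Finset.mul_sum, Finset.sum_mul]
    exact Finset.sum_eq_zero fun i _ => hd i _ (SetLike.coe_mem _)
  intro d
  induction d using Nat.strong_induction_on with
  | _ d ih =>
  let T : A →ₗ[k] A := LinearMap.mulRight k f ∘ₗ LinearMap.mulLeft k e
  let Y : Submodule k A := (𝒜 d).map T
  have hT : ∀ b, b ∈ 𝒜 d → e * b * f ∈ Y := fun b hb => ⟨b, hb, rfl⟩
  have hterm : ∀ u v, Φ u = 0 → Φ v = 0 →
      e * (decompose 𝒜 (u * v) d : A) * f ∈ r * Y + Y * r := by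
    intro u v hu hv
    rw [decompose_mul, coe_mul_apply_eq_sum_antidiagonal, Finset.mul_sum, Finset.sum_mul]
    refine sum_mem fun p hp => ?_
    obtain ⟨i, j⟩ := p
    have hij : i + j = d := Finset.HasAntidiagonal.mem_antidiagonal.1 hp
    change e * ((decompose 𝒜 u i : A) * (decompose 𝒜 v j : A)) * f ∈ _
    set u' : A := (decompose 𝒜 u i : A)
    set v' : A := (decompose 𝒜 v j : A)
    have hui : u' ∈ 𝒜 i := SetLike.coe_mem _
    have hvj : v' ∈ 𝒜 j := SetLike.coe_mem _
    have hsplit : e * (u' * v') * f =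
        (e * u' * e) * (e * v' * f) + (e * u' * f) * (f * v' * f) := by
      calc e * (u' * v') * f = e * u' * (e + f) * v' * f := by rw [hef]; noncomm_ring
        _ = e * u' * (e * e + f * f) * v' * f := by rw [he, hf]
        _ = _ := by noncomm_ring
    rw [hsplit]
    refine add_mem ?_ ?_
    · rcases eq_or_ne j d with rfl | hj
      · obtain rfl : i = 0 := by omega
        exact Submodule.mem_sup_left (Submodule.mul_mem_mul (hcomp he0 hu) (hT _ hvj))
      · rw [ih j (by omega) v' hvj, mul_zero]
        exact zero_mem _
    · rcases eq_or_ne i d with rfl | hi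
      · obtain rfl : j = 0 := by omega
        exact Submodule.mem_sup_right (Submodule.mul_mem_mul (hT _ hui) (hcomp hf0 hv))
      · rw [ih i (by omega) u' hui, zero_mul]
        exact zero_mem _
  have hsq : ∀ z ∈ RingHom.ker Φ * RingHom.ker Φ,
      e * (decompose 𝒜 z d : A) * f ∈ r * Y + Y * r := by
    intro z hz
    induction hz using Submodule.mul_induction_on' with
    | mem_mul_mem u hu v hv => exact hterm u v hu hv
    | add x _ y _ hx hy =>
      rw [decompose_add, DirectSum.add_apply, Submodule.coe_add, mul_add, add_mul]
      exact add_mem hx hy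
  have hY : Y = ⊥ := by
    refine eq_bot_of_le_mul_add_mul hr ?_
    rintro _ ⟨b, hb, rfl⟩
    change e * b * f ∈ _
    have hmem : e * b * f ∈ 𝒜 d := by
      simpa using SetLike.mul_mem_graded (SetLike.mul_mem_graded he0 hb) hf0
    have := hsq _ (h b)
    rw [decompose_of_mem_same 𝒜 hmem] at this
    convert this using 1
    rw [show e * (e * b * f) * f = (e * e) * b * (f * f) by noncomm_ring, he, hf]
  intro b hb
  have := hT b hb
  rwa [hY, Submodule.mem_bot] at this

/-- An ideal of the degree zero part of a graded algebra, as a subspace of the whole algebra. -/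
def Ideal.gradeZeroSubmodule {A : Type*} [Ring A] {k : Type*} [Field k] [Algebra k A]
    {𝒜 : ℕ → Submodule k A} [GradedAlgebra 𝒜] (I : Ideal (𝒜 0)) : Submodule k A where
  carrier := {a | ∃ x ∈ I, (x : A) = a}
  zero_mem' := ⟨0, zero_mem I, rfl⟩
  add_mem' := by
    rintro _ _ ⟨x, hx, rfl⟩ ⟨y, hy, rfl⟩
    exact ⟨x + y, add_mem hx hy, rfl⟩
  smul_mem' := by
    rintro c _ ⟨x, hx, rfl⟩
    exact ⟨algebraMap k (𝒜 0) c * x, I.mul_mem_left _ hx, (Algebra.smul_def c (x : A)).symm⟩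

theorem Ideal.isNilpotent_gradeZeroSubmodule {A : Type*} [Ring A] {k : Type*} [Field k]
    [Algebra k A] {𝒜 : ℕ → Submodule k A} [GradedAlgebra 𝒜] {I : Ideal (𝒜 0)}
    (hI : IsNilpotent I) : IsNilpotent I.gradeZeroSubmodule := by
  obtain ⟨n, hn⟩ := hI
  have key : ∀ n : ℕ, I.gradeZeroSubmodule ^ n ≤ (I ^ n).gradeZeroSubmodule := by
    intro n
    induction n with
    | zero =>
      rw [Submodule.pow_zero, Submodule.pow_zero, Submodule.one_le]
      exact ⟨1, by simp, rfl⟩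
    | succ n ih =>
      rw [Submodule.pow_succ, Submodule.pow_succ]
      refine (mul_le_mul_left ih _).trans (Submodule.mul_le.2 ?_)
      rintro _ ⟨x, hx, rfl⟩ _ ⟨y, hy, rfl⟩
      exact ⟨x * y, Ideal.mul_mem_mul hx hy, rfl⟩
  refine ⟨n, le_bot_iff.1 ((key n).trans ?_)⟩
  rintro _ ⟨x, hx, rfl⟩
  rw [hn] at hx
  have hx0 : x = 0 := hx
  simp [hx0]

theorem nonempty_ringEquiv_corner_prod {A : Type} [Ring A] {e f : A} (he : e * e = e)
    (hf : f * f = f) (hef : e + f = 1) (h₁ : ∀ a : A, e * a * f = 0)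
    (h₂ : ∀ a : A, f * a * e = 0) :
    letI := cornerRing A he
    letI := cornerRing A hf
    Nonempty (A ≃+* (↥(cornerNUS A e) × ↥(cornerNUS A f))) := by
  letI := cornerRing A he
  letI := cornerRing A hf
  have hfe : f * e = 0 := by simpa using h₂ 1
  have hef' : e * f = 0 := by simpa using h₁ 1
  have hc : ∀ a, e * a = a * e := fun a => by
    calc e * a = e * a * (e + f) := by rw [hef, mul_one]
      _ = (e + f) * a * e := by rw [mul_add, h₁, add_mul, add_mul, h₂]
      _ = a * e := by rw [hef, one_mul]
  have hc' : ∀ a, f * a = a * f := fun a => by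
    rw [← eq_sub_iff_add_eq'] at hef
    rw [hef, sub_mul, mul_sub, hc, one_mul, mul_one]
  refine ⟨RingEquiv.symm
    { toFun := fun p => p.1.1 + p.2.1
      invFun := fun a => (⟨e * a, by rw [← mul_assoc, he], by rw [← hc, ← mul_assoc, he]⟩,
        ⟨f * a, by rw [← mul_assoc, hf], by rw [← hc', ← mul_assoc, hf]⟩)
      left_inv := ?_
      right_inv := fun a => by
        change e * a + f * a = a
        rw [← add_mul, hef, one_mul]
      map_mul' := ?_
      map_add' := ?_ }⟩
  · rintro ⟨⟨x, hx, hx'⟩, ⟨y, hy, hy'⟩⟩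
    refine Prod.ext (Subtype.ext ?_) (Subtype.ext ?_)
    · change e * (x + y) = x
      rw [mul_add, hx, ← hy, ← mul_assoc, hef', zero_mul, add_zero]
    · change f * (x + y) = y
      rw [mul_add, hy, ← hx, ← mul_assoc, hfe, zero_mul, zero_add]
  · rintro ⟨⟨x, hx, hx'⟩, ⟨y, hy, hy'⟩⟩ ⟨⟨z, hz, hz'⟩, ⟨w, hw, hw'⟩⟩
    change x * z + y * w = (x + y) * (z + w)
    have h1 : x * w = 0 := by rw [← hx', ← hw, mul_assoc, ← mul_assoc e, hef', zero_mul, mul_zero]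
    have h2 : y * z = 0 := by rw [← hy', ← hz, mul_assoc, ← mul_assoc f, hfe, zero_mul, mul_zero]
    rw [add_mul, mul_add, mul_add, h1, h2, add_zero, zero_add]
  · rintro ⟨x, y⟩ ⟨z, w⟩
    exact add_add_add_comm _ _ _ _

theorem mem_radJ_iff {A : Type} [Ring A] {k : Type} [Field k] [Algebra k A]
    {𝒜 : ℕ → Submodule k A} [GradedAlgebra 𝒜] (a : A) :
    a ∈ radJ A k 𝒜 ↔
      GradedRing.projZeroRingHom' 𝒜 a ∈ Ideal.jacobson (⊥ : Ideal (𝒜 0)) := by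
  constructor
  · intro ha
    induction ha using Submodule.span_induction with
    | mem x hx =>
      rcases hx with ⟨y, hy, rfl⟩ | ⟨i, hi, hx⟩
      · simpa using hy
      · have : GradedRing.projZeroRingHom' 𝒜 x = 0 := by
          ext
          simpa using DirectSum.decompose_of_mem_ne 𝒜 hx (by omega : i ≠ 0)
        rw [this]
        exact zero_mem _
    | zero => simp
    | add x y _ _ hx hy => rw [map_add]; exact add_mem hx hy
    | smul c x _ hx =>
      rw [MulOpposite.smul_eq_mul_unop, map_mul]
      exact Ideal.mul_mem_right _ _ hx
  · intro ha
    classical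
    rw [← DirectSum.sum_support_decompose 𝒜 a]
    refine sum_mem fun i _ => Submodule.subset_span ?_
    rcases Nat.eq_zero_or_pos i with rfl | hi
    · exact Or.inl ⟨_, ha, rfl⟩
    · exact Or.inr ⟨i, hi, SetLike.coe_mem _⟩

/-- **Lemma (`connected`, main step).**  Let `A` be a basic locally finite `ℕ`-graded
algebra over a field `k`, let `J = rad(A₀) ⊕ A_{≥1}` and `Ā = A/J`.  If `e, f ∈ A₀` are
idempotents with `e + f = 1` and `Ext¹_A(eĀ, fĀ) = 0 = Ext¹_A(fĀ, eĀ)`, then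
`eAf = 0 = fAe`; consequently `A ≅ eAe × fAf` as rings. -/
theorem stmt_15
    (hlocfin : ∀ i : ℕ, FiniteDimensional k (𝒜 i))
    (hbasic : IsBasic k ↥(𝒜 0))
    (e f : A) (he0 : e ∈ 𝒜 0) (hf0 : f ∈ 𝒜 0)
    (he : e * e = e) (hf : f * f = f) (hef : e + f = 1)
    (hext₁ : ¬ HasNonsplitExt Aᵐᵒᵖ ↥(cornerBar A k 𝒜 e) ↥(cornerBar A k 𝒜 f))
    (hext₂ : ¬ HasNonsplitExt Aᵐᵒᵖ ↥(cornerBar A k 𝒜 f) ↥(cornerBar A k 𝒜 e)) :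
    (∀ a : A, e * a * f = 0) ∧ (∀ a : A, f * a * e = 0) ∧
    (letI := cornerRing A he
     letI := cornerRing A hf
     Nonempty (A ≃+* (↥(cornerNUS A e) × ↥(cornerNUS A f)))) := by
  obtain ⟨n, D, hD, hDA, φ, hφ, hker⟩ := hbasic
  have : IsArtinianRing (𝒜 0) := by
    have : @Module.Finite k (𝒜 0) _ _ Algebra.toModule := hlocfin 0
    have : @IsScalarTower k (𝒜 0) (𝒜 0) Algebra.toSMul _ Algebra.toSMul := IsScalarTower.right
    exact @IsArtinianRing.of_finite k (𝒜 0) _ _ Algebra.toModule _ _ _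
  let Φ : A →+* ∀ i, D i := (φ : 𝒜 0 →+* ∀ i, D i).comp (GradedRing.projZeroRingHom' 𝒜)
  have hΦ : Function.Surjective Φ :=
    hφ.comp (GradedRing.projZeroRingHom'_surjective 𝒜)
  have hφJ : ∀ b, φ b = 0 ↔ b ∈ Ideal.jacobson (⊥ : Ideal (𝒜 0)) := by
    intro b
    rw [← hker]
    rfl
  have hJ : ∀ a, a ∈ radJ A k 𝒜 ↔ Φ a = 0 := fun a => by
    rw [mem_radJ_iff, ← hφJ]
    rfl
  have hΦ0 : ∀ a, Φ (DirectSum.decompose 𝒜 a 0 : A) = Φ a := fun a => by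
    change φ (GradedRing.projZeroRingHom' 𝒜 (DirectSum.decompose 𝒜 a 0 : A)) = _
    rw [GradedRing.projZeroRingHom'_apply_coe]
    rfl
  have hr : ∀ b, b ∈ (Ideal.jacobson (⊥ : Ideal (𝒜 0))).gradeZeroSubmodule ↔
      b ∈ 𝒜 0 ∧ Φ b = 0 := by
    refine fun b => ⟨?_, fun ⟨hb, h⟩ => ⟨⟨b, hb⟩, ?_, rfl⟩⟩
    · rintro ⟨y, hy, rfl⟩
      refine ⟨y.2, ?_⟩
      change φ (GradedRing.projZeroRingHom' 𝒜 (y : A)) = 0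
      rw [GradedRing.projZeroRingHom'_apply_coe]
      exact (hφJ y).2 hy
    · rw [← GradedRing.projZeroRingHom'_apply_coe 𝒜 ⟨b, hb⟩]
      exact (hφJ _).1 h
  have hfe : f + e = 1 := by rw [add_comm, hef]
  have hnil := Ideal.isNilpotent_gradeZeroSubmodule
    (IsArtinianRing.isNilpotent_jacobson_bot (R := 𝒜 0))
  have h₁ := mul_mul_eq_zero_of_mem_ker_mul_ker hΦ0 hnil hr he0 hf0 he hf hef
    (mul_mul_mem_ker_mul_ker hΦ hJ he hf hef hext₁)
  have h₂ := mul_mul_eq_zero_of_mem_ker_mul_ker hΦ0 hnil hr hf0 he0 hf he hfe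
    (mul_mul_mem_ker_mul_ker hΦ hJ hf he hfe hext₂)
  exact ⟨h₁, h₂, nonempty_ringEquiv_corner_prod he hf hef h₁ h₂⟩

end
end

section
/- Let n ≥ 1 and m₁, …, mₙ ∈ ℕ with Σ_{k=1}^{n} m_k ≥ 1. Define m : {1,…,n}² → ℤ by m(i, i) := 0, m(i, j) := Σ_{k=i}^{j−1} m_k for i < j, and m(i, j) := Σ_{k=i}^{n} m_k + Σ_{k=1}^{j−1} m_k for i > j. Let ν be the cyclic permutation of {1,…,n} given by ν(i) = i+1 for i < n and ν(n) = 1. Then: (a) m(i, k) + m(k, j) ≥ m(i, j) for all i, j, k ∈ {1,…,n}; (b) m(i, j) + m(j, i) = Σ_{k=1}^{n} m_k > 0 for all i ≠ j; (c) m(ν(i), j) + m(j, i) = Σ_{k=1}^{n} m_k − m_i for all i, j ∈ {1,…,n}. -/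
open Finset

/-- The exponent matrix of the cyclic Gorenstein tiled order attached to
`m₁, …, mₙ ∈ ℕ`: `m(i,i) = 0`, `m(i,j) = ∑_{k=i}^{j−1} m_k` for `i < j`, and
`m(i,j) = ∑_{k=i}^{n} m_k + ∑_{k=1}^{j−1} m_k` for `i > j`. -/
def cyclicExp (n : ℕ) (c : ℕ → ℕ) (i j : ℕ) : ℤ :=
  if i < j then ∑ l ∈ Finset.Ico i j, (c l : ℤ)
  else if j < i then (∑ l ∈ Finset.Icc i n, (c l : ℤ)) + ∑ l ∈ Finset.Ico 1 j, (c l : ℤ)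
  else 0

/-- The cyclic permutation `ν` of `{1,…,n}`: `ν(i) = i + 1` for `i < n`, and `ν(n) = 1`. -/
def cyclicPerm (n : ℕ) (i : ℕ) : ℕ := if i < n then i + 1 else 1

/-- The prefix-sum form of `cyclicExp`: a coboundary plus a full turn when `j < i`. -/
theorem cyclicExp_eq (n : ℕ) (c : ℕ → ℕ) {i j : ℕ} (hi : i ∈ Finset.Icc 1 n)
    (hj : j ∈ Finset.Icc 1 n) :
    cyclicExp n c i j = ∑ l ∈ Finset.Ico 1 j, (c l : ℤ) - ∑ l ∈ Finset.Ico 1 i, (c l : ℤ) +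
      if j < i then ∑ l ∈ Finset.Icc 1 n, (c l : ℤ) else 0 := by
  rw [Finset.mem_Icc] at hi hj
  unfold cyclicExp
  rcases lt_trichotomy i j with h | rfl | h
  · have := Finset.sum_Ico_consecutive (fun l => (c l : ℤ)) hi.1 h.le
    rw [if_pos h, if_neg h.not_gt]
    linarith
  · simp
  · have := Finset.sum_Ico_consecutive (fun l => (c l : ℤ)) hi.1 (Nat.le_succ_of_le hi.2)
    rw [if_neg h.not_gt, if_pos h, if_pos h]
    simp only [← Finset.Ico_add_one_right_eq_Icc]
    simp only [Nat.succ_eq_add_one] at this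
    linarith

/-- **(Cyclic Gorenstein tiled orders, Section 7.2.)**  Let `n ≥ 1` and
`m₁, …, mₙ ∈ ℕ` with `∑ m_k ≥ 1`, and let `m` be the exponent matrix defined above and `ν`
the cyclic permutation of `{1,…,n}`.  Then:
(a) `m(i,l) + m(l,j) ≥ m(i,j)` for all `i, j, l` (so `m` defines a tiled order);
(b) `m(i,j) + m(j,i) = ∑_{k=1}^{n} m_k > 0` for all `i ≠ j` (so the order is basic);
(c) `m(ν(i), j) + m(j, i) = ∑_{k=1}^{n} m_k − m_i` for all `i, j`
(the Gorenstein condition with Nakayama permutation `ν`). -/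
theorem stmt_17 (n : ℕ) (hn : 1 ≤ n) (c : ℕ → ℕ)
    (hsum : 1 ≤ ∑ l ∈ Finset.Icc 1 n, c l) :
    (∀ i ∈ Finset.Icc 1 n, ∀ j ∈ Finset.Icc 1 n, ∀ l ∈ Finset.Icc 1 n,
      cyclicExp n c i j ≤ cyclicExp n c i l + cyclicExp n c l j) ∧
    (∀ i ∈ Finset.Icc 1 n, ∀ j ∈ Finset.Icc 1 n, i ≠ j →
      cyclicExp n c i j + cyclicExp n c j i = ∑ l ∈ Finset.Icc 1 n, (c l : ℤ)) ∧
    (0 < ∑ l ∈ Finset.Icc 1 n, (c l : ℤ)) ∧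
    (∀ i ∈ Finset.Icc 1 n, ∀ j ∈ Finset.Icc 1 n,
      cyclicExp n c (cyclicPerm n i) j + cyclicExp n c j i =
        (∑ l ∈ Finset.Icc 1 n, (c l : ℤ)) - (c i : ℤ)) := by
  have hpos : 0 < ∑ l ∈ Finset.Icc 1 n, (c l : ℤ) := by exact_mod_cast hsum
  refine ⟨fun i hi j hj l hl => ?_, fun i hi j hj hij => ?_, hpos, fun i hi j hj => ?_⟩
  · rw [cyclicExp_eq n c hi hj, cyclicExp_eq n c hi hl, cyclicExp_eq n c hl hj]
    split_ifs <;> omega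
  · rw [cyclicExp_eq n c hi hj, cyclicExp_eq n c hj hi]
    split_ifs <;> omega
  · have hi' := Finset.mem_Icc.mp hi
    have hj' := Finset.mem_Icc.mp hj
    have hstep := Finset.sum_Ico_succ_top hi'.1 (fun l => (c l : ℤ))
    unfold cyclicPerm
    split_ifs with h
    · rw [cyclicExp_eq n c (Finset.mem_Icc.mpr ⟨by omega, h⟩) hj, cyclicExp_eq n c hj hi]
      split_ifs <;> first | omega | linarith
    · obtain rfl : i = n := by omega
      rw [cyclicExp_eq i c (Finset.mem_Icc.mpr ⟨le_rfl, hn⟩) hj, cyclicExp_eq i c hj hi,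
        if_neg (by omega), if_neg (by omega), Finset.Ico_self, Finset.sum_empty,
        ← Finset.Ico_add_one_right_eq_Icc]
      linarith
end
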